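/- Let 1 < p < ∞, m ∈ ℕ, 0 ≤ ℓ < d and a₀ ∈ ℝ. Suppose 2d(1/p − 1/2) < m < d/p and set t := d / (2d/p − m) and ã₁ := 2a₀ − m. Then for every a₁ < ã₁ there exists a constant c such that ‖u·v | 𝒦^m_{a₁,t}(ℝ^d,ℝ^ℓ_*)‖ ≤ c ‖u | 𝒦^m_{a₀,p}(ℝ^d,ℝ^ℓ_*)‖ · ‖v | 𝒦^m_{a₀,p}(ℝ^d,ℝ^ℓ_*)‖ holds for all u, v ∈ 𝒦^m_{a₀,p}(ℝ^d,ℝ^ℓ_*). -/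

import Mathlib

open MeasureTheory Metric Set Filter
open scoped Topology ENNReal NNReal

noncomputable section

/-- `d`-dimensional Euclidean space. -/
abbrev Ed (d : ℕ) : Type := EuclideanSpace ℝ (Fin d)

/-- The finite set of all multi-indices `α : Fin d → ℕ` with `|α| = ∑ i, α i ≤ m`. -/
def multiIdx (d m : ℕ) : Finset (Fin d → ℕ) :=
  (Fintype.piFinset fun _ : Fin d => Finset.range (m + 1)).filter fun α => ∑ i, α i ≤ m

/-- First-order partial derivative in the `i`-th coordinate direction. -/
def pderivI (d : ℕ) (i : Fin d) (f : Ed d → ℝ) : Ed d → ℝ :=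
  fun x => fderiv ℝ f x (EuclideanSpace.single i 1)

/-- Iterated partial derivative `∂^α`. -/
def pderivA (d : ℕ) (α : Fin d → ℕ) (f : Ed d → ℝ) : Ed d → ℝ :=
  ((List.finRange d).foldr (fun i g => (pderivI d i)^[α i] ∘ g) id) f

/-- Smooth compactly supported test functions with support inside `Ω`. -/
def IsTestFun (d : ℕ) (Ω : Set (Ed d)) (φ : Ed d → ℝ) : Prop :=
  ContDiff ℝ (⊤ : ℕ∞) φ ∧ HasCompactSupport φ ∧ tsupport φ ⊆ Ω

/-- `v` is the `α`-th weak (distributional) derivative of `u` on `Ω`. -/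
def HasWeakDerivOn (d : ℕ) (Ω : Set (Ed d)) (α : Fin d → ℕ) (u v : Ed d → ℝ) : Prop :=
  LocallyIntegrableOn u Ω volume ∧ LocallyIntegrableOn v Ω volume ∧
    ∀ φ : Ed d → ℝ, IsTestFun d Ω φ →
      ∫ x in Ω, u x * pderivA d α φ x = (-1 : ℝ) ^ (∑ i, α i) * ∫ x in Ω, v x * φ x

/-- `D` is a family of weak derivatives of `u` on `Ω` for all multi-indices of order `≤ m`. -/
def IsWeakDerivFamily (d : ℕ) (Ω : Set (Ed d)) (m : ℕ) (u : Ed d → ℝ)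
    (D : (Fin d → ℕ) → Ed d → ℝ) : Prop :=
  ∀ α ∈ multiIdx d m, HasWeakDerivOn d Ω α u (D α)

/-- `x ↦ (ρ(x)^(|α|-a) |v(x)|)^p`, the integrand in the Kondratiev norm. -/
def kIntegrand (d : ℕ) (ρ : Ed d → ℝ) (a p : ℝ) (α : Fin d → ℕ) (v : Ed d → ℝ) : Ed d → ℝ :=
  fun x => (ρ x ^ (((∑ i, α i : ℕ) : ℝ) - a) * |v x|) ^ p

/-- The Kondratiev norm computed from a family `D` of weak derivatives. -/
def KnormP (d : ℕ) (Ω : Set (Ed d)) (ρ : Ed d → ℝ) (m : ℕ) (a p : ℝ)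
    (D : (Fin d → ℕ) → Ed d → ℝ) : ℝ :=
  (∑ α ∈ multiIdx d m, ∫ x in Ω, kIntegrand d ρ a p α (D α) x) ^ (1 / p)

/-- `D` witnesses membership of `u` in the Kondratiev space `𝒦^m_{a,p}(Ω, M)`
    (with weight function `ρ`). -/
def KMemData (d : ℕ) (Ω : Set (Ed d)) (ρ : Ed d → ℝ) (m : ℕ) (a p : ℝ)
    (u : Ed d → ℝ) (D : (Fin d → ℕ) → Ed d → ℝ) : Prop :=
  IsWeakDerivFamily d Ω m u D ∧
    ∀ α ∈ multiIdx d m, IntegrableOn (kIntegrand d ρ a p α (D α)) Ω volume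

/-- Membership in the Kondratiev space `𝒦^m_{a,p}(Ω, M)` with weight `ρ`, `p < ∞`. -/
def MemK (d : ℕ) (Ω : Set (Ed d)) (ρ : Ed d → ℝ) (m : ℕ) (a p : ℝ) (u : Ed d → ℝ) : Prop :=
  ∃ D, KMemData d Ω ρ m a p u D

open Classical in
/-- The Kondratiev norm of `u` (computed from a choice of weak derivative family;
    it is a.e. independent of this choice). -/
def Knorm (d : ℕ) (Ω : Set (Ed d)) (ρ : Ed d → ℝ) (m : ℕ) (a p : ℝ) (u : Ed d → ℝ) : ℝ :=
  if h : MemK d Ω ρ m a p u then KnormP d Ω ρ m a p h.choose else 0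

/-- `x ↦ ρ(x)^(|α|-a) v(x)`, the function whose `L_∞` norm enters the norm for `p = ∞`. -/
def kIntegrandInf (d : ℕ) (ρ : Ed d → ℝ) (a : ℝ) (α : Fin d → ℕ) (v : Ed d → ℝ) : Ed d → ℝ :=
  fun x => ρ x ^ (((∑ i, α i : ℕ) : ℝ) - a) * v x

/-- `D` witnesses membership of `u` in `𝒦^m_{a,∞}(Ω, M)`. -/
def KMemDataInf (d : ℕ) (Ω : Set (Ed d)) (ρ : Ed d → ℝ) (m : ℕ) (a : ℝ)
    (u : Ed d → ℝ) (D : (Fin d → ℕ) → Ed d → ℝ) : Prop :=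
  IsWeakDerivFamily d Ω m u D ∧
    ∀ α ∈ multiIdx d m,
      eLpNorm (kIntegrandInf d ρ a α (D α)) ⊤ (volume.restrict Ω) < ⊤

/-- Membership in `𝒦^m_{a,∞}(Ω, M)`. -/
def MemKInf (d : ℕ) (Ω : Set (Ed d)) (ρ : Ed d → ℝ) (m : ℕ) (a : ℝ) (u : Ed d → ℝ) : Prop :=
  ∃ D, KMemDataInf d Ω ρ m a u D

/-- The `𝒦^m_{a,∞}` norm computed from a family `D` of weak derivatives. -/
def KnormInfP (d : ℕ) (Ω : Set (Ed d)) (ρ : Ed d → ℝ) (m : ℕ) (a : ℝ)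
    (D : (Fin d → ℕ) → Ed d → ℝ) : ℝ :=
  ∑ α ∈ multiIdx d m, (eLpNorm (kIntegrandInf d ρ a α (D α)) ⊤ (volume.restrict Ω)).toReal

open Classical in
/-- The `𝒦^m_{a,∞}(Ω, M)` norm of `u`. -/
def KnormInf (d : ℕ) (Ω : Set (Ed d)) (ρ : Ed d → ℝ) (m : ℕ) (a : ℝ) (u : Ed d → ℝ) : ℝ :=
  if h : MemKInf d Ω ρ m a u then KnormInfP d Ω ρ m a h.choose else 0

/-- The subspace `ℝ^ℓ_* = {x : x₁ = ⋯ = x_{d-ℓ} = 0}` of `ℝ^d`. -/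
def RStar (d ℓ : ℕ) : Set (Ed d) := {x | ∀ i : Fin d, (i : ℕ) < d - ℓ → x i = 0}

/-- The weight `ρ(x) = min(1, |x'|)` for the model case `(ℝ^d, ℝ^ℓ_*)`. -/
def rhoModel (d ℓ : ℕ) (x : Ed d) : ℝ :=
  min 1 (Real.sqrt (∑ i ∈ Finset.univ.filter (fun i : Fin d => (i : ℕ) < d - ℓ), (x i) ^ 2))

/-- The model domain `ℝ^d ∖ ℝ^ℓ_*`. -/
def ModelDomain (d ℓ : ℕ) : Set (Ed d) := (RStar d ℓ)ᶜ

/-- Membership in the model Kondratiev space `𝒦^m_{a,p}(ℝ^d, ℝ^ℓ_*)`, `p < ∞`. -/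
def MemKM (d ℓ m : ℕ) (a p : ℝ) (u : Ed d → ℝ) : Prop :=
  MemK d (ModelDomain d ℓ) (rhoModel d ℓ) m a p u

/-- The norm of the model Kondratiev space `𝒦^m_{a,p}(ℝ^d, ℝ^ℓ_*)`, `p < ∞`. -/
def KnormM (d ℓ m : ℕ) (a p : ℝ) (u : Ed d → ℝ) : ℝ :=
  Knorm d (ModelDomain d ℓ) (rhoModel d ℓ) m a p u

/-- Membership in the model Kondratiev space `𝒦^m_{a,∞}(ℝ^d, ℝ^ℓ_*)`. -/
def MemKMInf (d ℓ m : ℕ) (a : ℝ) (u : Ed d → ℝ) : Prop :=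
  MemKInf d (ModelDomain d ℓ) (rhoModel d ℓ) m a u

/-- The norm of the model Kondratiev space `𝒦^m_{a,∞}(ℝ^d, ℝ^ℓ_*)`. -/
def KnormMInf (d ℓ m : ℕ) (a : ℝ) (u : Ed d → ℝ) : ℝ :=
  KnormInf d (ModelDomain d ℓ) (rhoModel d ℓ) m a u

namespace Kon

lemma mem_multiIdx {d m : ℕ} {α : Fin d → ℕ} : α ∈ multiIdx d m ↔ ∑ i, α i ≤ m := by
  unfold multiIdx
  simp only [Finset.mem_filter, Fintype.mem_piFinset, Finset.mem_range, and_iff_right_iff_imp]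
  intro h i
  have := Finset.single_le_sum (f := α) (fun j _ => Nat.zero_le _) (Finset.mem_univ i)
  omega

abbrev Smooth {d : ℕ} (f : Ed d → ℝ) : Prop := ContDiff ℝ (⊤ : ℕ∞) f

lemma Smooth.pderivI {d : ℕ} {f : Ed d → ℝ} (hf : Smooth f) (i : Fin d) :
    Smooth (pderivI d i f) := by
  unfold _root_.pderivI
  exact (hf.fderiv_right (m := ((⊤ : ℕ∞) : WithTop ℕ∞)) (by simp)).clm_apply contDiff_const

lemma pderivI_comm {d : ℕ} {f : Ed d → ℝ} (hf : Smooth f) (i j : Fin d) :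
    pderivI d i (pderivI d j f) = pderivI d j (pderivI d i f) := by
  funext x
  have h2 : ContDiffAt ℝ 2 f x := (hf.of_le (WithTop.coe_le_coe.2 le_top)).contDiffAt
  have hsym := h2.isSymmSndFDerivAt (by simp)
  have hd : DifferentiableAt ℝ (fderiv ℝ f) x :=
    ((hf.fderiv_right (m := ((⊤ : ℕ∞) : WithTop ℕ∞)) (by simp)).differentiable (by simp)) x
  have key : ∀ k l : Fin d, pderivI d k (pderivI d l f) x =
      fderiv ℝ (fderiv ℝ f) x (EuclideanSpace.single k 1) (EuclideanSpace.single l 1) := by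
    intro k l
    unfold _root_.pderivI
    rw [fderiv_clm_apply hd (differentiableAt_const _)]
    simp
  rw [key, key]
  exact hsym _ _

lemma Smooth.iter {d : ℕ} {f : Ed d → ℝ} (hf : Smooth f) (i : Fin d) (k : ℕ) :
    Smooth ((_root_.pderivI d i)^[k] f) := by
  induction k with
  | zero => simpa using hf
  | succ k ih => rw [Function.iterate_succ_apply']; exact ih.pderivI i

lemma pderivI_iter_comm {d : ℕ} {f : Ed d → ℝ} (hf : Smooth f) (i j : Fin d) (k : ℕ) :
    pderivI d i ((pderivI d j)^[k] f) = (pderivI d j)^[k] (pderivI d i f) := by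
  induction k with
  | zero => rfl
  | succ k ih =>
    rw [Function.iterate_succ_apply', Function.iterate_succ_apply', ← ih,
      pderivI_comm (hf.iter j k)]

def TL (d : ℕ) (L : List (Fin d)) (α : Fin d → ℕ) : (Ed d → ℝ) → (Ed d → ℝ) :=
  L.foldr (fun i g => (pderivI d i)^[α i] ∘ g) id

lemma TL_cons {d : ℕ} (j : Fin d) (L : List (Fin d)) (α : Fin d → ℕ) (f : Ed d → ℝ) :
    TL d (j :: L) α f = (pderivI d j)^[α j] (TL d L α f) := rfl

lemma TL_smooth {d : ℕ} (L : List (Fin d)) (α : Fin d → ℕ) {f : Ed d → ℝ} (hf : Smooth f) :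
    Smooth (TL d L α f) := by
  induction L with
  | nil => exact hf
  | cons j L ih => rw [TL_cons]; exact ih.iter j _

lemma TL_comm {d : ℕ} (L : List (Fin d)) (α : Fin d → ℕ) {f : Ed d → ℝ} (hf : Smooth f)
    (i : Fin d) : pderivI d i (TL d L α f) = TL d L α (pderivI d i f) := by
  induction L with
  | nil => rfl
  | cons j L ih => rw [TL_cons, TL_cons, pderivI_iter_comm (TL_smooth L α hf), ih]

lemma TL_add {d : ℕ} (L : List (Fin d)) (hL : L.Nodup) (α : Fin d → ℕ) {f : Ed d → ℝ}
    (hf : Smooth f) (i : Fin d) :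
    (i ∉ L → TL d L (α + Pi.single i 1) f = TL d L α f) ∧
    (i ∈ L → TL d L (α + Pi.single i 1) f = TL d L α (pderivI d i f)) := by
  induction L with
  | nil => exact ⟨fun _ => rfl, fun h => by simp at h⟩
  | cons j L ih =>
    have ih := ih hL.of_cons
    have hj : j ∉ L := (List.nodup_cons.1 hL).1
    constructor
    · intro hi
      have h1 : i ≠ j := fun h => hi (by simp [h])
      have h2 : i ∉ L := fun h => hi (by simp [h])
      rw [TL_cons, TL_cons, ih.1 h2]
      simp [Ne.symm h1]
    · intro hi
      by_cases h1 : i = j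
      · subst h1
        rw [TL_cons, TL_cons, ih.1 hj, ← TL_comm L α hf]
        simp
      · have h2 : i ∈ L := by simpa [h1] using hi
        rw [TL_cons, TL_cons, ih.2 h2]
        simp [Ne.symm h1]

lemma pderivA_add {d : ℕ} (α : Fin d → ℕ) {f : Ed d → ℝ} (hf : Smooth f) (i : Fin d) :
    pderivA d (α + Pi.single i 1) f = pderivA d α (pderivI d i f) :=
  (TL_add (List.finRange d) (List.nodup_finRange d) α hf i).2 (List.mem_finRange i)

lemma pderivA_zero {d : ℕ} (f : Ed d → ℝ) : pderivA d 0 f = f := by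
  have : ∀ L : List (Fin d), TL d L 0 f = f := by
    intro L
    induction L with
    | nil => rfl
    | cons j L ih => rw [TL_cons, ih]; rfl
  exact this _

lemma tsupport_pderivI {d : ℕ} (f : Ed d → ℝ) (i : Fin d) :
    tsupport (pderivI d i f) ⊆ tsupport f := by
  refine closure_minimal ?_ (isClosed_tsupport f)
  intro x hx
  by_contra h
  apply hx
  have : fderiv ℝ f x = 0 := by
    by_contra h2
    exact h (support_fderiv_subset ℝ h2)
  simp [pderivI, this]

lemma test_pderivI {d : ℕ} {Ω : Set (Ed d)} {φ : Ed d → ℝ} (h : IsTestFun d Ω φ) (i : Fin d) :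
    IsTestFun d Ω (pderivI d i φ) :=
  ⟨Smooth.pderivI h.1 i, h.2.1.of_isClosed_subset (isClosed_tsupport _) (tsupport_pderivI _ _),
    (tsupport_pderivI _ _).trans h.2.2⟩

lemma test_mul {d : ℕ} {Ω : Set (Ed d)} {φ ψ : Ed d → ℝ} (h : IsTestFun d Ω φ) (hψ : Smooth ψ) :
    IsTestFun d Ω (fun x => φ x * ψ x) :=
  ⟨h.1.mul hψ, h.2.1.mul_right, (tsupport_mul_subset_left).trans h.2.2⟩

lemma pderivI_mul {d : ℕ} {φ ψ : Ed d → ℝ} (hφ : Smooth φ) (hψ : Smooth ψ) (i : Fin d) (x : Ed d) :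
    pderivI d i (fun x => φ x * ψ x) x = φ x * pderivI d i ψ x + ψ x * pderivI d i φ x := by
  unfold pderivI
  rw [fderiv_fun_mul (hφ.differentiable (by simp) x) (hψ.differentiable (by simp) x)]
  simp

/-- first-order weak derivative, with integrals over the whole space -/
def WD (d : ℕ) (Ω : Set (Ed d)) (i : Fin d) (f g : Ed d → ℝ) : Prop :=
  LocallyIntegrableOn f Ω volume ∧ LocallyIntegrableOn g Ω volume ∧
    ∀ φ : Ed d → ℝ, IsTestFun d Ω φ → ∫ x, f x * pderivI d i φ x = - ∫ x, g x * φ x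

lemma setInt_test {d : ℕ} {Ω : Set (Ed d)} {φ : Ed d → ℝ} (h : tsupport φ ⊆ Ω) (f : Ed d → ℝ) :
    ∫ x in Ω, f x * φ x = ∫ x, f x * φ x := by
  apply setIntegral_eq_integral_of_forall_compl_eq_zero
  intro x hx
  have : φ x = 0 := by
    by_contra h2
    exact hx (h (subset_tsupport _ h2))
  simp [this]

lemma tsupport_pderivA {d : ℕ} (f : Ed d → ℝ) (α : Fin d → ℕ) :
    tsupport (pderivA d α f) ⊆ tsupport f := by
  have h1 : ∀ (j : Fin d) (k : ℕ) (g : Ed d → ℝ), tsupport ((pderivI d j)^[k] g) ⊆ tsupport g := by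
    intro j k g
    induction k with
    | zero => rfl
    | succ k ih => rw [Function.iterate_succ_apply']; exact (tsupport_pderivI _ _).trans ih
  have : ∀ L : List (Fin d), tsupport (TL d L α f) ⊆ tsupport f := by
    intro L
    induction L with
    | nil => rfl
    | cons j L ih => rw [TL_cons]; exact (h1 _ _ _).trans ih
  exact this _

lemma sum_add_single {d : ℕ} (α : Fin d → ℕ) (i : Fin d) :
    ∑ j, (α + Pi.single i 1 : Fin d → ℕ) j = ∑ j, α j + 1 := by
  simp [Finset.sum_add_distrib]

lemma weak_step {d : ℕ} {Ω : Set (Ed d)} {α : Fin d → ℕ} {i : Fin d} {u f g : Ed d → ℝ}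
    (hf : HasWeakDerivOn d Ω α u f) (hg : HasWeakDerivOn d Ω (α + Pi.single i 1) u g) :
    WD d Ω i f g := by
  refine ⟨hf.2.1, hg.2.1, fun φ hφ => ?_⟩
  have h1 := hf.2.2 _ (test_pderivI hφ i)
  have h2 := hg.2.2 _ hφ
  rw [pderivA_add α hφ.1, h1, sum_add_single, setInt_test (test_pderivI hφ i).2.2,
    setInt_test hφ.2.2, pow_succ] at h2
  have h3 : ((-1 : ℝ) ^ ∑ j, α j) ≠ 0 := by positivity
  have h4 : (-1 : ℝ) ^ (∑ j, α j) * (∫ x, f x * pderivI d i φ x) =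
     (-1 : ℝ) ^ (∑ j, α j) * (- ∫ x, g x * φ x) := by rw [h2]; ring
  exact mul_left_cancel₀ h3 h4

lemma weak_build {d : ℕ} {Ω : Set (Ed d)} {α : Fin d → ℕ} {i : Fin d} {u f g : Ed d → ℝ}
    (hf : HasWeakDerivOn d Ω α u f) (hg : WD d Ω i f g) :
    HasWeakDerivOn d Ω (α + Pi.single i 1) u g := by
  refine ⟨hf.1, hg.2.1, fun φ hφ => ?_⟩
  have h1 := hf.2.2 _ (test_pderivI hφ i)
  have h2 := hg.2.2 _ hφ
  rw [pderivA_add α hφ.1, h1, sum_add_single, setInt_test (test_pderivI hφ i).2.2,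
    setInt_test hφ.2.2, pow_succ, h2]
  ring

lemma weak_unique {d : ℕ} {Ω : Set (Ed d)} (hΩ : IsOpen Ω) {α : Fin d → ℕ} {u f g : Ed d → ℝ}
    (hf : HasWeakDerivOn d Ω α u f) (hg : HasWeakDerivOn d Ω α u g) :
    f =ᵐ[volume.restrict Ω] g := by
  have h := hΩ.ae_eq_zero_of_integral_contDiff_smul_eq_zero (μ := volume)
    (f := fun x => f x - g x) (hf.2.1.sub hg.2.1) ?_
  · rw [Filter.EventuallyEq, ae_restrict_iff' hΩ.measurableSet]
    filter_upwards [h] with x hx hx2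
    linarith [hx hx2]
  · intro φ h1 h2 h3
    have hφ : IsTestFun d Ω φ := ⟨h1, h2, h3⟩
    have e := (hf.2.2 φ hφ).symm.trans (hg.2.2 φ hφ)
    rw [setInt_test h3, setInt_test h3] at e
    have e := mul_left_cancel₀ (by positivity) e
    have hint : ∀ w : Ed d → ℝ, LocallyIntegrableOn w Ω volume →
        Integrable (fun x => w x * φ x) := by
      intro w hw
      have hK : IntegrableOn w (tsupport φ) volume := hw.integrableOn_compact_subset h3 h2
      have : IntegrableOn (fun x => w x * φ x) (tsupport φ) :=
        hK.mul_continuousOn h1.continuous.continuousOn h2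
      rwa [integrableOn_iff_integrable_of_support_subset] at this
      intro x hx
      apply subset_tsupport
      intro h0
      simp [h0] at hx
    have := integral_sub (hint f hf.2.1) (hint g hg.2.1)
    rw [e, sub_self] at this
    rw [← this]
    congr 1
    funext x
    simp only [smul_eq_mul]
    ring

end Kon

namespace Kon
open scoped Convolution

def bump (d : ℕ) (n : ℕ) : ContDiffBump (0 : Ed d) where
  rIn := 1 / (2 * ((n : ℝ) + 1))
  rOut := 1 / ((n : ℝ) + 1)
  rIn_pos := by positivity
  rIn_lt_rOut := by
    apply one_div_lt_one_div_of_lt <;> nlinarith [(Nat.cast_nonneg n : (0:ℝ) ≤ n)]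

lemma bump_rOut_tendsto (d : ℕ) : Tendsto (fun n => (bump d n).rOut) atTop (𝓝 0) :=
  tendsto_one_div_add_atTop_nhds_zero_nat

def moll (d n : ℕ) (F : Ed d → ℝ) : Ed d → ℝ :=
  ((bump d n).normed volume ⋆[ContinuousLinearMap.lsmul ℝ ℝ, volume] F)

lemma moll_smooth {d : ℕ} (n : ℕ) {F : Ed d → ℝ} (hF : LocallyIntegrable F volume) :
    Smooth (moll d n F) :=
  HasCompactSupport.contDiff_convolution_left _ (bump d n).hasCompactSupport_normed
    (bump d n).contDiff_normed hF

lemma moll_compact {d : ℕ} (n : ℕ) {F : Ed d → ℝ} (hF : HasCompactSupport F) :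
    HasCompactSupport (moll d n F) :=
  HasCompactSupport.convolution _ (bump d n).hasCompactSupport_normed hF

lemma moll_tsupport {d : ℕ} (n : ℕ) {F : Ed d → ℝ} {K : Set (Ed d)} (hK : IsCompact K)
    (hF : Function.support F ⊆ K) :
    tsupport (moll d n F) ⊆ cthickening (1 / ((n : ℝ) + 1)) K := by
  refine closure_minimal ?_ isClosed_cthickening
  refine (support_convolution_subset _).trans ?_
  rw [(bump d n).support_normed_eq]
  intro x hx
  obtain ⟨a, ha, b, hb, rfl⟩ := Set.mem_add.1 hx
  apply thickening_subset_cthickening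
  rw [mem_thickening_iff]
  refine ⟨b, hF hb, ?_⟩
  rw [mem_ball_zero_iff] at ha
  simpa [dist_eq_norm, bump] using ha

lemma moll_ae {d : ℕ} {F : Ed d → ℝ} (hF : LocallyIntegrable F volume) :
    ∀ᵐ x, Tendsto (fun n => moll d n F x) atTop (𝓝 (F x)) := by
  refine ContDiffBump.ae_convolution_tendsto_right_of_locallyIntegrable (K := 2)
    (bump_rOut_tendsto d) ?_ hF
  filter_upwards with n
  simp only [bump]
  apply le_of_eq
  field_simp

lemma moll_deriv {d : ℕ} (n : ℕ) {F G : Ed d → ℝ} {i : Fin d}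
    (h : WD d univ i F G) : pderivI d i (moll d n F) = moll d n G := by
  have hF : LocallyIntegrable F volume := locallyIntegrableOn_univ.1 h.1
  set k := (bump d n).normed (volume : Measure (Ed d)) with hk
  have hkc : HasCompactSupport k := (bump d n).hasCompactSupport_normed
  have hks : Smooth k := (bump d n).contDiff_normed
  funext x
  have h1 := HasCompactSupport.hasFDerivAt_convolution_left
    (ContinuousLinearMap.lsmul ℝ ℝ) hkc (hks.of_le (by exact_mod_cast le_top)) hF x (μ := volume)
  unfold pderivI moll
  rw [← hk, h1.fderiv]
  have hint : Integrable (fun t => (ContinuousLinearMap.precompL (Ed d)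
      (ContinuousLinearMap.lsmul ℝ ℝ : ℝ →L[ℝ] ℝ →L[ℝ] ℝ)) (fderiv ℝ k t) (F (x - t))) := by
    have := HasCompactSupport.convolutionExists_left
      (ContinuousLinearMap.precompL (Ed d)
        (ContinuousLinearMap.lsmul ℝ ℝ : ℝ →L[ℝ] ℝ →L[ℝ] ℝ)) (hkc.fderiv ℝ)
      (hks.continuous_fderiv (by simp)) hF (μ := volume) x
    exact this
  have h2 : ((fderiv ℝ k ⋆[ContinuousLinearMap.precompL (Ed d)
      (ContinuousLinearMap.lsmul ℝ ℝ : ℝ →L[ℝ] ℝ →L[ℝ] ℝ), volume] F) x)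
      (EuclideanSpace.single i 1) = ∫ t, pderivI d i k t * F (x - t) := by
    rw [convolution_def, ContinuousLinearMap.integral_apply hint]
    rfl
  rw [h2]
  have h3 : ∫ t, pderivI d i k t * F (x - t) = ∫ t, F t * pderivI d i k (x - t) := by
    rw [← integral_sub_left_eq_self _ volume x]
    congr 1
    funext t
    rw [sub_sub_cancel, mul_comm]
  rw [h3, convolution_lsmul_swap]
  have hψ : IsTestFun d univ (fun t => k (x - t)) := by
    refine ⟨hks.comp (contDiff_const.sub contDiff_id), ?_, subset_univ _⟩
    exact hkc.comp_homeomorph (Homeomorph.subLeft x)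
  have h4 := h.2.2 _ hψ
  have h5 : ∀ t, pderivI d i (fun t => k (x - t)) t = - pderivI d i k (x - t) := by
    intro t
    unfold pderivI
    have h6 : HasFDerivAt (fun t : Ed d => x - t) (-(ContinuousLinearMap.id ℝ (Ed d))) t :=
      (hasFDerivAt_id t).const_sub x
    have h7 : HasFDerivAt k (fderiv ℝ k (x - t)) (x - t) :=
      (hks.differentiable (by simp) _).hasFDerivAt
    have h8 := h7.comp t h6
    have h9 : fderiv ℝ (fun t => k (x - t)) t = _ := h8.fderiv
    rw [h9]
    simp
  simp only [h5, mul_neg, integral_neg, neg_inj] at h4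
  rw [h4]
  congr 1
  funext t
  simp [mul_comm]

lemma translate_tendsto {d : ℕ} {F : Ed d → ℝ} {q : ℝ≥0∞} (hq : 1 ≤ q) (hq' : q ≠ ∞)
    (hF : MemLp F q volume) :
    Tendsto (fun t : Ed d => eLpNorm (fun x => F (x - t) - F x) q volume) (𝓝 0) (𝓝 0) := by
  have : Fact (1 ≤ q) := ⟨hq⟩
  let g : Ed d → C(Ed d, Ed d) := fun t => ⟨fun x => x - t, by fun_prop⟩
  have hg : Continuous g := by
    have : Continuous (Function.uncurry fun (t x : Ed d) => x - t) := by
      unfold Function.uncurry; fun_prop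
    exact (ContinuousMap.curry ⟨_, this⟩).continuous
  have hgm : ∀ t, MeasurePreserving (g t) (volume : Measure (Ed d)) volume :=
    fun t => measurePreserving_sub_right volume t
  have h := Filter.Tendsto.compMeasurePreservingLp (tendsto_const_nhds (x := hF.toLp F))
    (hg.tendsto 0) hgm (hgm 0) hq'
  have h0 : Lp.compMeasurePreserving (g 0) (hgm 0) (hF.toLp F) = hF.toLp F := by
    rw [Lp.toLp_compMeasurePreserving hF (hgm 0)]
    congr 1
    funext x
    simp [g]
  rw [h0] at h
  have h := (tendsto_iff_edist_tendsto_0).1 h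
  refine h.congr fun t => ?_
  rw [Lp.toLp_compMeasurePreserving hF (hgm t), Lp.edist_toLp_toLp]
  rfl

lemma moll_aux {d : ℕ} (n : ℕ) {F : Ed d → ℝ} {q : ℝ≥0} (hq : 1 ≤ q)
    (hFm : StronglyMeasurable F) (hF : MemLp F q volume) {ε : ℝ≥0∞}
    (hε : ∀ t ∈ ball (0 : Ed d) (1 / ((n : ℝ) + 1)),
      eLpNorm (fun x => F (x - t) - F x) q volume ≤ ε) :
    eLpNorm (fun x => moll d n F x - F x) q volume ≤ ε := by
  have hFl : LocallyIntegrable F volume := hF.locallyIntegrable (by exact_mod_cast hq)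
  set k := (bump d n).normed (volume : Measure (Ed d)) with hk
  have hkc : HasCompactSupport k := (bump d n).hasCompactSupport_normed
  have hkcont : Continuous k := (bump d n).continuous_normed
  have hk0 : ∀ x, 0 ≤ k x := (bump d n).nonneg_normed
  let kN : Ed d → ℝ≥0 := fun x => (k x).toNNReal
  have hkN : Measurable kN := hkcont.measurable.real_toNNReal
  let ν : Measure (Ed d) := volume.withDensity (fun x => (kN x : ℝ≥0∞))
  have hν : IsProbabilityMeasure ν := by
    constructor
    rw [withDensity_apply _ MeasurableSet.univ, Measure.restrict_univ]
    have := ofReal_integral_eq_lintegral_ofReal (bump d n).integrable_normed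
      (Eventually.of_forall hk0) (μ := volume)
    rw [(bump d n).integral_normed, ENNReal.ofReal_one] at this
    exact this.symm
  have hball : ∀ᵐ t ∂ν, t ∈ ball (0 : Ed d) (1 / ((n : ℝ) + 1)) := by
    rw [ae_withDensity_iff hkN.coe_nnreal_ennreal]
    filter_upwards with t ht
    have : t ∈ Function.support k := by
      intro h0
      apply ht
      simp [kN, h0]
    rw [hk, (bump d n).support_normed_eq] at this
    exact this
  have hconv : ∀ x, moll d n F x = ∫ t, F (x - t) ∂ν := by
    intro x
    rw [integral_withDensity_eq_integral_smul hkN]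
    unfold moll
    rw [convolution_lsmul]
    congr 1
    funext t
    simp [kN, NNReal.smul_def, hk0 t, ← hk]
  have hex : ∀ x, Integrable (fun t => F (x - t)) ν := by
    intro x
    rw [integrable_withDensity_iff_integrable_smul hkN]
    have := HasCompactSupport.convolutionExists_left
      (ContinuousLinearMap.lsmul ℝ ℝ : ℝ →L[ℝ] ℝ →L[ℝ] ℝ) hkc hkcont hFl (μ := volume) x
    refine Integrable.congr this (Eventually.of_forall fun t => ?_)
    simp [kN, NNReal.smul_def, hk0 t]
  have hmeas : Measurable (fun z : Ed d × Ed d => F (z.1 - z.2) - F z.1) := by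
    have := hFm.measurable
    fun_prop
  have hq0 : (q : ℝ) ≠ 0 := by
    have : (0:ℝ≥0) < q := lt_of_lt_of_le one_pos hq
    exact_mod_cast this.ne'
  have hq0' : (q : ℝ≥0) ≠ 0 := by exact_mod_cast hq0
  have hpt : ∀ x, ‖moll d n F x - F x‖ₑ ^ (q : ℝ) ≤
      ∫⁻ t, ‖F (x - t) - F x‖ₑ ^ (q : ℝ) ∂ν := by
    intro x
    have e1 : moll d n F x - F x = ∫ t, (F (x - t) - F x) ∂ν := by
      rw [integral_sub (hex x) (integrable_const _), hconv]
      simp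
    have hm : AEStronglyMeasurable (fun t => F (x - t) - F x) ν :=
      ((hex x).sub (integrable_const _)).aestronglyMeasurable
    calc ‖moll d n F x - F x‖ₑ ^ (q : ℝ) ≤ (eLpNorm (fun t => F (x - t) - F x) q ν) ^ (q : ℝ) := by
          apply ENNReal.rpow_le_rpow _ (by positivity)
          rw [e1]
          refine (enorm_integral_le_lintegral_enorm _).trans ?_
          rw [← eLpNorm_one_eq_lintegral_enorm]
          exact eLpNorm_le_eLpNorm_of_exponent_le (by exact_mod_cast hq) hm
      _ = _ := eLpNorm_nnreal_pow_eq_lintegral hq0'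
  have hmain : (eLpNorm (fun x => moll d n F x - F x) q volume) ^ (q : ℝ) ≤ ε ^ (q : ℝ) := by
    rw [eLpNorm_nnreal_pow_eq_lintegral hq0']
    calc ∫⁻ x, ‖moll d n F x - F x‖ₑ ^ (q : ℝ)
        ≤ ∫⁻ x, ∫⁻ t, ‖F (x - t) - F x‖ₑ ^ (q : ℝ) ∂ν := lintegral_mono hpt
      _ = ∫⁻ t, (∫⁻ x, ‖F (x - t) - F x‖ₑ ^ (q : ℝ)) ∂ν := by
          apply lintegral_lintegral_swap
          exact (hmeas.enorm.pow_const _).aemeasurable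
      _ ≤ ∫⁻ t, ε ^ (q : ℝ) ∂ν := by
          apply lintegral_mono_ae
          filter_upwards [hball] with t ht
          rw [← eLpNorm_nnreal_pow_eq_lintegral hq0' (f := fun x => F (x - t) - F x)]
          exact ENNReal.rpow_le_rpow (hε t ht) (by positivity)
      _ = ε ^ (q : ℝ) := by simp
  exact (ENNReal.rpow_le_rpow_iff (by positivity)).1 hmain

lemma moll_tendsto {d : ℕ} {F : Ed d → ℝ} {q : ℝ≥0} (hq : 1 ≤ q) (hF : MemLp F q volume) :
    Tendsto (fun n => eLpNorm (fun x => moll d n F x - F x) q volume) atTop (𝓝 0) := by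
  let F' := hF.1.mk F
  have hae : F =ᵐ[volume] F' := hF.1.ae_eq_mk
  have hF' : MemLp F' q volume := (memLp_congr_ae hae).1 hF
  have hF'm : StronglyMeasurable F' := hF.1.stronglyMeasurable_mk
  have hconv : ∀ n, moll d n F = moll d n F' := fun n =>
    convolution_congr _ (Filter.EventuallyEq.refl _ _) hae
  have heq : ∀ n, eLpNorm (fun x => moll d n F x - F x) q volume =
      eLpNorm (fun x => moll d n F' x - F' x) q volume := by
    intro n
    apply eLpNorm_congr_ae
    filter_upwards [hae] with x hx
    rw [hconv, hx]
  simp only [heq]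
  rw [ENNReal.tendsto_nhds_zero]
  intro ε hε
  have ht := (ENNReal.tendsto_nhds_zero.1
    (translate_tendsto (by exact_mod_cast hq) ENNReal.coe_ne_top hF')) ε hε
  obtain ⟨δ, hδ, hb⟩ := Metric.eventually_nhds_iff_ball.1 ht
  have := (tendsto_one_div_add_atTop_nhds_zero_nat (𝕜 := ℝ)).eventually (gt_mem_nhds hδ)
  filter_upwards [this] with n hn
  exact moll_aux n hq hF'm hF' fun t ht => hb t (ball_subset_ball hn.le ht)

end Kon

namespace Kon

/-- local `L^q` on compact subsets of `Ω` -/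
def LL (d : ℕ) (Ω : Set (Ed d)) (q : ℝ≥0∞) (f : Ed d → ℝ) : Prop :=
  ∀ K : Set (Ed d), IsCompact K → K ⊆ Ω → MemLp f q (volume.restrict K)

lemma LL.mono {d : ℕ} {Ω : Set (Ed d)} {q r : ℝ≥0∞} {f : Ed d → ℝ} (h : LL d Ω q f)
    (hr : r ≤ q) : LL d Ω r f := by
  intro K hK hKΩ
  have : IsFiniteMeasure ((volume : Measure (Ed d)).restrict K) :=
    isFiniteMeasure_restrict.2 hK.measure_lt_top.ne
  exact (h K hK hKΩ).mono_exponent hr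

lemma int_test {d : ℕ} {Ω : Set (Ed d)} {w φ : Ed d → ℝ} (hw : LocallyIntegrableOn w Ω volume)
    (hφ : IsTestFun d Ω φ) : Integrable (fun x => w x * φ x) := by
  have hK : IntegrableOn w (tsupport φ) volume := hw.integrableOn_compact_subset hφ.2.2 hφ.2.1
  have : IntegrableOn (fun x => w x * φ x) (tsupport φ) :=
    hK.mul_continuousOn hφ.1.continuous.continuousOn hφ.2.1
  rwa [integrableOn_iff_integrable_of_support_subset] at this
  intro x hx
  apply subset_tsupport
  intro h0
  simp [h0] at hx

lemma LL.test {d : ℕ} {Ω : Set (Ed d)} {q : ℝ≥0∞} {f φ : Ed d → ℝ} (h : LL d Ω q f)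
    (hφ : IsTestFun d Ω φ) : MemLp (fun x => f x * φ x) q volume := by
  have hK := h _ hφ.2.1 hφ.2.2
  obtain ⟨C, hC⟩ := hφ.2.1.exists_bound_of_continuous hφ.1.continuous
  have h1 : MemLp (fun x => f x * φ x) q (volume.restrict (tsupport φ)) := by
    refine hK.of_le_mul (c := C) (hK.1.mul hφ.1.continuous.aestronglyMeasurable) ?_
    filter_upwards with x
    rw [norm_mul, mul_comm]
    exact mul_le_mul_of_nonneg_right (hC x) (norm_nonneg _)
  rw [← memLp_indicator_iff_restrict (isClosed_tsupport φ).measurableSet] at h1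
  refine (congrArg (fun w => MemLp w q volume) ?_).mpr h1
  funext x
  by_cases hx : x ∈ tsupport φ
  · rw [indicator_of_mem hx]
  · rw [indicator_of_notMem hx, image_eq_zero_of_notMem_tsupport hx, mul_zero]

/-- localization of a weak derivative by a test function -/
lemma WD.localize {d : ℕ} {Ω : Set (Ed d)} {i : Fin d} {f g φ : Ed d → ℝ} (h : WD d Ω i f g)
    (hφ : IsTestFun d Ω φ) :
    WD d univ i (fun x => f x * φ x) (fun x => g x * φ x + f x * pderivI d i φ x) := by
  refine ⟨(int_test h.1 hφ).locallyIntegrable.locallyIntegrableOn _,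
    ((int_test h.2.1 hφ).add (int_test h.1 (test_pderivI hφ i))).locallyIntegrable.locallyIntegrableOn _,
    fun ψ hψ => ?_⟩
  have h1 := h.2.2 _ (test_mul hφ hψ.1)
  have t1 := test_mul hφ (Smooth.pderivI hψ.1 i)
  have t2 := test_mul (test_pderivI hφ i) hψ.1
  have e1 : ∫ x, f x * pderivI d i (fun x => φ x * ψ x) x =
      (∫ x, f x * (φ x * pderivI d i ψ x)) + ∫ x, f x * (pderivI d i φ x * ψ x) := by
    rw [← integral_add (int_test h.1 t1) (int_test h.1 t2)]
    congr 1
    funext x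
    rw [pderivI_mul hφ.1 hψ.1]
    ring
  have e2 : ∫ x, (g x * φ x + f x * pderivI d i φ x) * ψ x =
      (∫ x, g x * (φ x * ψ x)) + ∫ x, f x * (pderivI d i φ x * ψ x) := by
    rw [← integral_add (int_test h.2.1 (test_mul hφ hψ.1)) (int_test h.1 t2)]
    congr 1
    funext x
    ring
  rw [e2]
  simp only [mul_assoc]
  rw [h1] at e1
  linarith

lemma norm_clm_le {d : ℕ} (L : Ed d →L[ℝ] ℝ) :
    ‖L‖ ≤ ∑ i, ‖L (EuclideanSpace.single i 1)‖ := by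
  refine L.opNorm_le_bound (by positivity) fun x => ?_
  have hx : x = ∑ i, x i • (EuclideanSpace.single i (1:ℝ) : Ed d) := by
    have := (EuclideanSpace.basisFun (Fin d) ℝ).sum_repr x
    simpa using this.symm
  conv_lhs => rw [hx]
  rw [map_sum, Finset.sum_mul]
  refine (norm_sum_le _ _).trans (Finset.sum_le_sum fun i _ => ?_)
  rw [map_smul, norm_smul, mul_comm]
  exact mul_le_mul_of_nonneg_left (EuclideanSpace.norm_eq x ▸ by
    have := PiLp.norm_apply_le x i
    simpa [EuclideanSpace.norm_eq] using this) (norm_nonneg _)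

theorem gns {d : ℕ} (hd : 0 < d) {q q' : ℝ≥0} (hq : 1 ≤ q)
    (hq' : (q' : ℝ)⁻¹ = (q : ℝ)⁻¹ - (d : ℝ)⁻¹) {F : Ed d → ℝ} {G : Fin d → Ed d → ℝ}
    (hFc : HasCompactSupport F) (hG : ∀ i, MemLp (G i) q volume)
    (hW : ∀ i, WD d univ i F (G i)) :
    eLpNorm F q' volume ≤
      (SNormLESNormFDerivOfEqConst ℝ (volume : Measure (Ed d)) q) *
        ∑ i, eLpNorm (G i) q volume := by
  have hFl : LocallyIntegrable F volume := locallyIntegrableOn_univ.1 (hW ⟨0, hd⟩).1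
  set C : ℝ≥0∞ := (SNormLESNormFDerivOfEqConst ℝ (volume : Measure (Ed d)) q : ℝ≥0∞)
  have hs := fun n => moll_smooth n hFl
  have h1 : ∀ n, eLpNorm (moll d n F) q' volume ≤
      C * ∑ i, (eLpNorm (fun x => moll d n (G i) x - G i x) q volume +
        eLpNorm (G i) q volume) := by
    intro n
    have h2 := eLpNorm_le_eLpNorm_fderiv_of_eq volume
      ((hs n).of_le (by exact_mod_cast le_top)) (moll_compact n hFc) (p := q) (p' := q') hq
      (by simpa using hd) (by simpa using hq')
    refine h2.trans (mul_le_mul_right ?_ _)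
    have hGl : ∀ i, LocallyIntegrable (G i) volume := fun i => locallyIntegrableOn_univ.1 (hW i).2.1
    calc eLpNorm (fderiv ℝ (moll d n F)) q volume
        ≤ eLpNorm (fun x => ∑ i, ‖moll d n (G i) x‖) q volume := by
          apply eLpNorm_mono
          intro x
          refine (norm_clm_le _).trans ?_
          rw [Real.norm_of_nonneg (by positivity)]
          apply le_of_eq
          refine Finset.sum_congr rfl fun i _ => ?_
          rw [← moll_deriv n (hW i)]
          rfl
      _ ≤ ∑ i, eLpNorm (fun x => ‖moll d n (G i) x‖) q volume := by
          have := eLpNorm_sum_le (s := Finset.univ) (f := fun (i : Fin d) x => ‖moll d n (G i) x‖)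
            (p := q) (μ := volume)
            (fun i _ => (moll_smooth n (hGl i)).continuous.norm.aestronglyMeasurable)
            (by exact_mod_cast hq)
          convert this using 2
          funext x; simp
      _ ≤ _ := by
          refine Finset.sum_le_sum fun i _ => ?_
          rw [eLpNorm_norm]
          have hm : AEStronglyMeasurable (fun x => moll d n (G i) x - G i x) volume :=
            (moll_smooth n (hGl i)).continuous.aestronglyMeasurable.sub (hG i).1
          have := eLpNorm_add_le hm (hG i).1 (p := q) (by exact_mod_cast hq)
          have e : ((fun x => moll d n (G i) x - G i x) + G i) = moll d n (G i) := by
            funext x; simp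
          rwa [e] at this
  have h3 := Lp.eLpNorm_lim_le_liminf_eLpNorm (p := q') (μ := volume)
    (fun n => (hs n).continuous.aestronglyMeasurable) F (moll_ae hFl)
  refine h3.trans ?_
  have h4 : Tendsto (fun n => C * ∑ i, (eLpNorm (fun x => moll d n (G i) x - G i x) q volume +
        eLpNorm (G i) q volume)) atTop (𝓝 (C * ∑ i, eLpNorm (G i) q volume)) := by
    refine ENNReal.Tendsto.const_mul ?_ (Or.inr ENNReal.coe_ne_top)
    refine tendsto_finsetSum _ fun i _ => ?_
    have := (moll_tendsto hq (hG i)).add (tendsto_const_nhds (x := eLpNorm (G i) q volume))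
    simpa using this
  rw [← h4.liminf_eq]
  exact liminf_le_liminf (Eventually.of_forall h1)

lemma pair_tendsto {d : ℕ} {a : ℝ≥0} {a' : ℝ≥0∞} (ha : 1 ≤ a)
    [hc : ENNReal.HolderConjugate a' a]
    {K0 K : Set (Ed d)} (hK0 : IsCompact K0) (hK : IsCompact K) {δ : ℝ} (hδ : 0 < δ)
    (hKK : cthickening δ K0 ⊆ K) {g G : Ed d → ℝ} (hG : MemLp G a volume)
    (hGs : Function.support G ⊆ K0) (hg : MemLp g a' (volume.restrict K)) :
    Tendsto (fun n => ∫ x, g x * moll d n G x) atTop (𝓝 (∫ x, g x * G x)) := by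
  have hGl : LocallyIntegrable G volume := hG.locallyIntegrable (by exact_mod_cast ha)
  have hKm := hK.isClosed.measurableSet
  have hset : ∀ H : Ed d → ℝ, Function.support H ⊆ K →
      ∫ x, g x * H x = ∫ x in K, g x * H x := by
    intro H hH
    symm
    apply setIntegral_eq_integral_of_forall_compl_eq_zero
    intro x hx
    have : H x = 0 := by
      by_contra h2
      exact hx (hH h2)
    simp [this]
  have hGK : Function.support G ⊆ K := (hGs.trans (self_subset_cthickening K0)).trans hKK
  rw [tendsto_iff_edist_tendsto_0]
  have hlim : Tendsto (fun n => eLpNorm g a' (volume.restrict K) *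
      eLpNorm (fun x => moll d n G x - G x) a volume) atTop (𝓝 0) := by
    have := ENNReal.Tendsto.const_mul (a := eLpNorm g a' (volume.restrict K))
      (moll_tendsto ha hG) (Or.inr hg.2.ne)
    simpa using this
  refine tendsto_of_tendsto_of_tendsto_of_le_of_le' tendsto_const_nhds hlim
    (Eventually.of_forall fun _ => zero_le) ?_
  have hev := (tendsto_one_div_add_atTop_nhds_zero_nat (𝕜 := ℝ)).eventually (gt_mem_nhds hδ)
  have hev2 := ENNReal.tendsto_nhds_zero.1 (moll_tendsto ha hG) 1 one_pos
  filter_upwards [hev, hev2] with n hn hn2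
  have hms : Function.support (moll d n G) ⊆ K :=
    (subset_tsupport _).trans ((moll_tsupport n hK0 hGs).trans
      ((cthickening_mono hn.le K0).trans hKK))
  rw [hset _ hms, hset _ hGK]
  have hmem : MemLp (fun x => moll d n G x - G x) a volume :=
    ⟨(moll_smooth n hGl).continuous.aestronglyMeasurable.sub hG.1,
      lt_of_le_of_lt hn2 ENNReal.one_lt_top⟩
  have hdiff : MemLp (fun x => moll d n G x - G x) a (volume.restrict K) := hmem.restrict K
  have hGr : MemLp G a (volume.restrict K) := hG.restrict K
  have hmr : MemLp (moll d n G) a (volume.restrict K) := by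
    have := hdiff.add hGr
    convert this using 1
    funext x; simp
  have i1 : IntegrableOn (fun x => g x * moll d n G x) K := memLp_one_iff_integrable.1 (hmr.mul hg)
  have i2 : IntegrableOn (fun x => g x * G x) K := memLp_one_iff_integrable.1 (hGr.mul hg)
  rw [edist_eq_enorm_sub, ← integral_sub i1 i2]
  refine (enorm_integral_le_lintegral_enorm _).trans ?_
  rw [← eLpNorm_one_eq_lintegral_enorm]
  have := eLpNorm_smul_le_mul_eLpNorm (r := 1) hdiff.1 hg.1 (p := a') (q := a)
  refine le_trans (le_of_eq ?_) (this.trans (mul_le_mul_right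
    (eLpNorm_mono_measure _ Measure.restrict_le_self) _))
  congr 1
  funext x
  simp only [Pi.smul_apply', smul_eq_mul]
  ring

lemma LL.locInt_mul {d : ℕ} {Ω : Set (Ed d)} (hΩ : IsOpen Ω) {f g : Ed d → ℝ} {a a' : ℝ≥0∞}
    [ENNReal.HolderConjugate a' a] (hf : LL d Ω a f) (hg : LL d Ω a' g) :
    LocallyIntegrableOn (fun x => f x * g x) Ω volume := by
  rw [locallyIntegrableOn_iff hΩ.isLocallyClosed]
  intro K hKΩ hK
  have := (hf K hK hKΩ).mul (hg K hK hKΩ) (r := 1)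
  refine (memLp_one_iff_integrable.1 this).congr (Eventually.of_forall fun x => ?_)
  simp [mul_comm]

theorem product_rule {d : ℕ} {Ω : Set (Ed d)} (hΩ : IsOpen Ω) {i : Fin d} {f fi g gi : Ed d → ℝ}
    (hf : WD d Ω i f fi) (hg : WD d Ω i g gi) {a b : ℝ≥0} {a' b' : ℝ≥0∞} (ha : 1 ≤ a) (hb : 1 ≤ b)
    [ENNReal.HolderConjugate a' a] [ENNReal.HolderConjugate b' b]
    (h1 : LL d Ω a f) (h2 : LL d Ω a fi) (h3 : LL d Ω a' g) (h4 : LL d Ω b f) (h5 : LL d Ω b' gi) :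
    WD d Ω i (fun x => f x * g x) (fun x => fi x * g x + f x * gi x) := by
  have L1 : LocallyIntegrableOn (fun x => f x * g x) Ω volume := h1.locInt_mul hΩ h3
  have L2 : LocallyIntegrableOn (fun x => fi x * g x) Ω volume := h2.locInt_mul hΩ h3
  have L3 : LocallyIntegrableOn (fun x => f x * gi x) Ω volume := h4.locInt_mul hΩ h5
  refine ⟨L1, L2.add L3, fun φ hφ => ?_⟩
  obtain ⟨δ, hδ, hδΩ⟩ := hφ.2.1.isCompact.exists_cthickening_subset_open hΩ hφ.2.2
  set K0 := tsupport φ with hK0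
  set K := cthickening δ K0 with hKdef
  have hK0c : IsCompact K0 := hφ.2.1
  have hKc : IsCompact K := hK0c.cthickening
  set F := fun x => f x * φ x with hF
  set G := fun x => fi x * φ x + f x * pderivI d i φ x with hG
  have hW : WD d univ i F G := hf.localize hφ
  have hFb : MemLp F b volume := h4.test hφ
  have hGa : MemLp G a volume := (h2.test hφ).add (h1.test (test_pderivI hφ i))
  have hFs : Function.support F ⊆ K0 := by
    intro x hx
    apply subset_tsupport
    intro h0
    simp [hF, h0] at hx
  have hGs : Function.support G ⊆ K0 := by
    intro x hx
    by_contra hxs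
    apply hx
    have e1 : φ x = 0 := image_eq_zero_of_notMem_tsupport hxs
    have e2 : pderivI d i φ x = 0 :=
      image_eq_zero_of_notMem_tsupport (fun h => hxs (tsupport_pderivI _ _ h))
    simp [hG, e1, e2]
  have T1 := pair_tendsto ha hK0c hKc hδ le_rfl hGa hGs (h3 K hKc hδΩ)
  have T2 := pair_tendsto hb hK0c hKc hδ le_rfl hFb hFs (h5 K hKc hδΩ)
  have hev := (tendsto_one_div_add_atTop_nhds_zero_nat (𝕜 := ℝ)).eventually (gt_mem_nhds hδ)
  have heq : ∀ᶠ n : ℕ in atTop, ∫ x, g x * moll d n G x = - ∫ x, gi x * moll d n F x := by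
    filter_upwards [hev] with n hn
    have ht : IsTestFun d Ω (moll d n F) :=
      ⟨moll_smooth n (locallyIntegrableOn_univ.1 hW.1),
        moll_compact n (HasCompactSupport.of_support_subset_isCompact hK0c hFs),
        (moll_tsupport n hK0c hFs).trans ((cthickening_mono hn.le K0).trans hδΩ)⟩
    rw [← hg.2.2 _ ht, moll_deriv n hW]
  have hlim := tendsto_nhds_unique (T1.congr' heq) T2.neg
  have e1 : ∫ x, g x * G x =
      (∫ x, (fun x => fi x * g x) x * φ x) + ∫ x, (fun x => f x * g x) x * pderivI d i φ x := by
    rw [← integral_add (int_test L2 hφ) (int_test L1 (test_pderivI hφ i))]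
    congr 1
    funext x
    simp only [hG]
    ring
  have e2 : ∫ x, (fi x * g x + f x * gi x) * φ x =
      (∫ x, (fun x => fi x * g x) x * φ x) + ∫ x, gi x * F x := by
    have e3 : ∫ x, gi x * F x = ∫ x, (fun x => f x * gi x) x * φ x := by
      congr 1
      funext x
      simp only [hF]
      ring
    rw [e3, ← integral_add (int_test L2 hφ) (int_test L3 hφ)]
    congr 1
    funext x
    ring
  rw [e2]
  rw [e1] at hlim
  linarith

end Kon

namespace Kon

def ssum (d : ℕ) (S : Finset (Fin d)) (x : Ed d) : ℝ := ∑ j ∈ S, (x j) ^ 2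

def SS (d ℓ : ℕ) : Finset (Fin d) := Finset.univ.filter (fun i : Fin d => (i : ℕ) < d - ℓ)

lemma ssum_nonneg {d : ℕ} (S : Finset (Fin d)) (x : Ed d) : 0 ≤ ssum d S x :=
  Finset.sum_nonneg fun _ _ => sq_nonneg _

lemma ssum_smooth {d : ℕ} (S : Finset (Fin d)) : Smooth (ssum d S) := by
  unfold ssum
  refine ContDiff.sum fun j _ => ?_
  exact (contDiff_piLp_apply 2).pow 2

lemma mem_dom {d ℓ : ℕ} {x : Ed d} : x ∈ ModelDomain d ℓ ↔ 0 < ssum d (SS d ℓ) x := by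
  unfold ModelDomain RStar
  rw [lt_iff_le_and_ne, and_iff_right (ssum_nonneg _ _), mem_compl_iff, not_iff_comm, not_ne_iff,
    eq_comm, ssum, Finset.sum_eq_zero_iff_of_nonneg (fun _ _ => sq_nonneg _)]
  simp [SS]

lemma dom_open (d ℓ : ℕ) : IsOpen (ModelDomain d ℓ) := by
  have : ModelDomain d ℓ = (ssum d (SS d ℓ)) ⁻¹' Ioi 0 := by
    ext x; exact mem_dom
  rw [this]
  exact isOpen_Ioi.preimage (ssum_smooth _).continuous

lemma rho_eq (d ℓ : ℕ) (x : Ed d) : rhoModel d ℓ x = min 1 (Real.sqrt (ssum d (SS d ℓ) x)) := rfl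

lemma rho_cont (d ℓ : ℕ) : Continuous (rhoModel d ℓ) := by
  have : rhoModel d ℓ = fun x => min 1 (Real.sqrt (ssum d (SS d ℓ) x)) := rfl
  rw [this]
  exact continuous_const.min (ssum_smooth _).continuous.sqrt

lemma rho_pos {d ℓ : ℕ} {x : Ed d} (hx : x ∈ ModelDomain d ℓ) : 0 < rhoModel d ℓ x := by
  rw [rho_eq]
  exact lt_min one_pos (Real.sqrt_pos.2 (mem_dom.1 hx))

lemma rho_le_one {d ℓ : ℕ} (x : Ed d) : rhoModel d ℓ x ≤ 1 := min_le_left _ _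

lemma rho_nonneg {d ℓ : ℕ} (x : Ed d) : 0 ≤ rhoModel d ℓ x :=
  le_min zero_le_one (Real.sqrt_nonneg _)

def rr (d ℓ : ℕ) (x : Ed d) : ℝ := ssum d (SS d ℓ) x / (1 + ssum d (SS d ℓ) x)

def ww (d : ℕ) (x : Ed d) : ℝ := (1 + ssum d Finset.univ x)⁻¹

lemma rr_smooth (d ℓ : ℕ) : Smooth (rr d ℓ) :=
  (ssum_smooth _).div (contDiff_const.add (ssum_smooth _)) fun x => by
    have := ssum_nonneg (SS d ℓ) x
    positivity

lemma ww_smooth (d : ℕ) : Smooth (ww d) :=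
  (contDiff_const.add (ssum_smooth _)).inv fun x => by
    have := ssum_nonneg Finset.univ x
    positivity

lemma rr_pos {d ℓ : ℕ} {x : Ed d} (hx : x ∈ ModelDomain d ℓ) : 0 < rr d ℓ x := by
  have := mem_dom.1 hx
  unfold rr; positivity

lemma rr_nonneg {d ℓ : ℕ} (x : Ed d) : 0 ≤ rr d ℓ x := by
  have := ssum_nonneg (SS d ℓ) x
  unfold rr; positivity

lemma rr_le_one {d ℓ : ℕ} (x : Ed d) : rr d ℓ x ≤ 1 := by
  have := ssum_nonneg (SS d ℓ) x
  unfold rr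
  rw [div_le_one (by positivity)]
  linarith

lemma ww_pos {d : ℕ} (x : Ed d) : 0 < ww d x := by
  have := ssum_nonneg Finset.univ x
  unfold ww; positivity

lemma ww_le_one {d : ℕ} (x : Ed d) : ww d x ≤ 1 := by
  have := ssum_nonneg Finset.univ x
  unfold ww
  exact inv_le_one_of_one_le₀ (by linarith)

lemma rho_sq (d ℓ : ℕ) (x : Ed d) :
    rr d ℓ x ≤ rhoModel d ℓ x ^ 2 ∧ rhoModel d ℓ x ^ 2 ≤ 2 * rr d ℓ x := by
  have h0 := ssum_nonneg (SS d ℓ) x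
  have h1 := rr_le_one (ℓ := ℓ) x
  rw [rho_eq]
  unfold rr at *
  set s := ssum d (SS d ℓ) x
  rcases le_total 1 (Real.sqrt s) with h | h
  · rw [min_eq_left h]
    have hs : 1 ≤ s := by
      rw [← Real.sq_sqrt h0]; nlinarith
    refine ⟨by simpa using h1, ?_⟩
    rw [← mul_div_assoc, le_div_iff₀ (by positivity)]
    linarith
  · rw [min_eq_right h, Real.sq_sqrt h0]
    have hs : s ≤ 1 := by
      rw [← Real.sq_sqrt h0]; nlinarith [Real.sqrt_nonneg s]
    constructor
    · rw [div_le_iff₀ (by positivity)]; nlinarith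
    · rw [← mul_div_assoc, le_div_iff₀ (by positivity)]; nlinarith

lemma rho_rr (d ℓ : ℕ) (e : ℝ) : ∃ C : ℝ, 0 < C ∧ ∀ x ∈ ModelDomain d ℓ,
    rr d ℓ x ^ (e / 2) ≤ C * rhoModel d ℓ x ^ e ∧ rhoModel d ℓ x ^ e ≤ C * rr d ℓ x ^ (e / 2) := by
  refine ⟨2 ^ (|e| / 2), by positivity, fun x hx => ?_⟩
  have hρ := rho_pos hx
  have hr := rr_pos hx
  obtain ⟨h1, h2⟩ := rho_sq d ℓ x
  have e1 : rhoModel d ℓ x ^ e = (rhoModel d ℓ x ^ 2) ^ (e / 2) := by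
    rw [← Real.rpow_natCast, ← Real.rpow_mul hρ.le]
    congr 1; push_cast; ring
  rw [e1]
  set P := rhoModel d ℓ x ^ 2 with hP
  have hP0 : 0 < P := by positivity
  set r := rr d ℓ x
  have hone : (1:ℝ) ≤ 2 ^ (|e| / 2) := Real.one_le_rpow (by norm_num) (by positivity)
  have hrp : 0 < r ^ (e/2) := by positivity
  have hPp : 0 < P ^ (e/2) := by positivity
  rcases le_total 0 e with he | he
  · have a1 : r ^ (e / 2) ≤ P ^ (e / 2) := Real.rpow_le_rpow hr.le h1 (by linarith)
    have a2 : P ^ (e / 2) ≤ (2 * r) ^ (e / 2) := Real.rpow_le_rpow hP0.le h2 (by linarith)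
    rw [Real.mul_rpow (by norm_num) hr.le] at a2
    rw [abs_of_nonneg he] at *
    exact ⟨by nlinarith, a2⟩
  · have a1 : P ^ (e / 2) ≤ r ^ (e / 2) := Real.rpow_le_rpow_of_nonpos hr h1 (by linarith)
    have a2 : (2 * r) ^ (e / 2) ≤ P ^ (e / 2) := Real.rpow_le_rpow_of_nonpos hP0 h2 (by linarith)
    rw [Real.mul_rpow (by norm_num) hr.le] at a2
    rw [abs_of_nonpos he] at *
    refine ⟨?_, by nlinarith⟩
    have a3 : (2:ℝ) ^ (-e / 2) * 2 ^ (e / 2) = 1 := by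
      rw [← Real.rpow_add (by norm_num)]
      ring_nf; simp
    calc r ^ (e/2) = 2 ^ (-e / 2) * (2 ^ (e / 2) * r ^ (e / 2)) := by rw [← mul_assoc, a3, one_mul]
      _ ≤ _ := mul_le_mul_of_nonneg_left a2 (by positivity)

/-- directional derivative along a coordinate line -/
def LD (d : ℕ) (i : Fin d) (f : Ed d → ℝ) (f' : ℝ) (x : Ed d) : Prop :=
  HasDerivAt (fun t : ℝ => f (x + t • (EuclideanSpace.single i (1:ℝ) : Ed d))) f' 0

lemma LD.pderivI {d : ℕ} {i : Fin d} {f : Ed d → ℝ} {f' : ℝ} {x : Ed d} (h : LD d i f f' x)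
    (hf : Smooth f) : pderivI d i f x = f' := by
  have h1 := (hf.differentiable (by simp) x).lineDeriv_eq_fderiv (v := EuclideanSpace.single i (1:ℝ))
  have h2 : HasLineDerivAt ℝ f f' x (EuclideanSpace.single i (1:ℝ)) := h
  rw [h2.lineDeriv] at h1
  exact h1.symm

lemma ssum_LD {d : ℕ} (S : Finset (Fin d)) (i : Fin d) (x : Ed d) :
    ∃ s', LD d i (ssum d S) s' x ∧ s' ^ 2 ≤ 4 * ssum d S x := by
  refine ⟨∑ j ∈ S, 2 * x j * (if j = i then 1 else 0), ?_, ?_⟩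
  · unfold LD ssum
    refine HasDerivAt.fun_sum fun j _ => ?_
    have h1 : HasDerivAt (fun t : ℝ => (x + t • (EuclideanSpace.single i (1:ℝ) : Ed d)) j)
        (if j = i then 1 else 0) 0 := by
      have e : (fun t : ℝ => (x + t • (EuclideanSpace.single i (1:ℝ) : Ed d)) j) =
          fun t => x j + t * (if j = i then 1 else 0) := by
        funext t
        simp [Pi.single_apply]
      rw [e]
      have := ((hasDerivAt_id (0:ℝ)).mul_const (if j = i then (1:ℝ) else 0)).const_add (x j)
      simpa using this
    have := h1.fun_pow 2
    simpa using this
  · by_cases hi : i ∈ S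
    · have : ∑ j ∈ S, 2 * x j * (if j = i then (1:ℝ) else 0) = 2 * x i := by
        simp [hi]
      rw [this]
      have h2 : (x i) ^ 2 ≤ ssum d S x :=
        Finset.single_le_sum (f := fun j => (x j)^2) (fun _ _ => sq_nonneg _) hi
      nlinarith
    · have : ∑ j ∈ S, 2 * x j * (if j = i then (1:ℝ) else 0) = 0 := by
        simp [hi]
      rw [this]
      nlinarith [ssum_nonneg S x]

lemma rr_LD {d ℓ : ℕ} (i : Fin d) (x : Ed d) :
    ∃ r', LD d i (rr d ℓ) r' x ∧ |r'| ≤ 2 * Real.sqrt (rr d ℓ x) := by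
  obtain ⟨s', h1, h2⟩ := ssum_LD (SS d ℓ) i x
  have h0 := ssum_nonneg (SS d ℓ) x
  set s := ssum d (SS d ℓ) x with hs
  have hd : HasDerivAt _ _ (0:ℝ) := HasDerivAt.div h1 (h1.const_add 1) (by
    simp only [zero_smul, add_zero]; positivity)
  simp only [zero_smul, add_zero] at hd
  refine ⟨_, hd, ?_⟩
  rw [← hs]
  have e : (s' * (1 + s) - s * s') / (1 + s) ^ 2 = s' / (1 + s) ^ 2 := by ring
  rw [e]
  apply abs_le_of_sq_le_sq _ (by positivity)
  rw [mul_pow, Real.sq_sqrt (rr_nonneg x), div_pow]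
  unfold rr
  rw [← hs, div_le_iff₀ (by positivity)]
  have : 2 ^ 2 * (s / (1 + s)) * ((1 + s) ^ 2) ^ 2 = 4 * s * (1 + s) ^ 3 := by
    field_simp
    ring
  rw [this]
  have : 1 ≤ (1 + s) ^ 3 := one_le_pow₀ (by linarith)
  nlinarith

lemma ww_LD {d : ℕ} (i : Fin d) (x : Ed d) :
    ∃ w', LD d i (ww d) w' x ∧ |w'| ≤ ww d x := by
  obtain ⟨s', h1, h2⟩ := ssum_LD Finset.univ i x
  have h0 := ssum_nonneg Finset.univ x
  set s := ssum d Finset.univ x with hs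
  have hd : HasDerivAt _ _ (0:ℝ) := HasDerivAt.inv (h1.const_add 1) (by
    simp only [zero_smul, add_zero]; positivity)
  simp only [zero_smul, add_zero] at hd
  refine ⟨_, hd, ?_⟩
  unfold ww
  rw [← hs, abs_div, abs_neg, abs_of_pos (by positivity : 0 < (1+s)^2), div_le_iff₀ (by positivity)]
  have : |s'| ≤ 1 + s := by
    apply abs_le_of_sq_le_sq _ (by positivity)
    nlinarith [sq_nonneg (1 - s)]
  calc |s'| ≤ 1 + s := this
    _ = (1 + s)⁻¹ * (1 + s) ^ 2 := by field_simp

def kap (t : ℝ) : ℝ := Real.smoothTransition (t - 1)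

lemma kap_smooth : ContDiff ℝ (⊤ : ℕ∞) kap :=
  Real.smoothTransition.contDiff.comp (contDiff_id.sub contDiff_const)

lemma kap_zero {t : ℝ} (h : t ≤ 1) : kap t = 0 := Real.smoothTransition.zero_of_nonpos (by linarith)
lemma kap_one {t : ℝ} (h : 2 ≤ t) : kap t = 1 := Real.smoothTransition.one_of_one_le (by linarith)
lemma kap_nonneg (t : ℝ) : 0 ≤ kap t := Real.smoothTransition.nonneg _
lemma kap_le_one (t : ℝ) : kap t ≤ 1 := Real.smoothTransition.le_one _

lemma kap_deriv : ∃ C : ℝ, 0 < C ∧ ∀ t, |deriv kap t * t| ≤ C := by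
  have hc : Continuous (fun t => deriv kap t * t) :=
    (kap_smooth.continuous_deriv (by simp)).mul continuous_id
  obtain ⟨C, hC⟩ := (isCompact_Icc (a := (0:ℝ)) (b := 3)).exists_bound_of_continuousOn hc.continuousOn
  refine ⟨max C 1, by positivity, fun t => ?_⟩
  by_cases ht : t ∈ Icc (0:ℝ) 3
  · exact (hC t ht).trans (le_max_left _ _)
  · have : deriv kap t = 0 := by
      rw [mem_Icc, not_and_or, not_le, not_le] at ht
      rcases ht with ht | ht
      · have : kap =ᶠ[𝓝 t] fun _ => 0 := by
          filter_upwards [Iio_mem_nhds ht] with y hy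
          exact kap_zero (by have := mem_Iio.1 hy; linarith)
        rw [this.deriv_eq]; simp
      · have : kap =ᶠ[𝓝 t] fun _ => 1 := by
          filter_upwards [Ioi_mem_nhds ht] with y hy
          exact kap_one (by have := mem_Ioi.1 hy; linarith)
        rw [this.deriv_eq]; simp
    rw [this]; simp

def cut (d ℓ : ℕ) (c : ℝ) (n : ℕ) (x : Ed d) : ℝ :=
  rr d ℓ x ^ (c / 2) * kap (n * (rr d ℓ x * ww d x))

lemma cut_test (d ℓ : ℕ) (c : ℝ) (n : ℕ) : IsTestFun d (ModelDomain d ℓ) (cut d ℓ c n) := by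
  have hcont : Continuous (fun x : Ed d => (n:ℝ) * (rr d ℓ x * ww d x)) :=
    continuous_const.mul ((rr_smooth d ℓ).continuous.mul (ww_smooth d).continuous)
  have hsm : Smooth (fun x : Ed d => (n:ℝ) * (rr d ℓ x * ww d x)) :=
    contDiff_const.mul ((rr_smooth d ℓ).mul (ww_smooth d))
  set A : Set (Ed d) := {x | 1 ≤ (n:ℝ) * (rr d ℓ x * ww d x)} with hA
  have hAc : IsClosed A := isClosed_le continuous_const hcont
  have hsup : tsupport (cut d ℓ c n) ⊆ A := by
    refine closure_minimal ?_ hAc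
    intro x hx
    by_contra h
    apply hx
    have : (n:ℝ) * (rr d ℓ x * ww d x) ≤ 1 := (not_le.1 h).le
    simp [cut, kap_zero this]
  have hAΩ : A ⊆ ModelDomain d ℓ := by
    intro x hx
    rw [mem_dom]
    by_contra h
    have h0 : ssum d (SS d ℓ) x = 0 := le_antisymm (not_lt.1 h) (ssum_nonneg _ _)
    simp only [hA, mem_ofPred_eq, rr, h0] at hx
    norm_num at hx
  have hAb : A ⊆ closedBall 0 (Real.sqrt n) := by
    intro x hx
    rw [mem_closedBall_zero_iff, EuclideanSpace.norm_eq]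
    apply Real.sqrt_le_sqrt
    have e : ∑ i, ‖x i‖ ^ 2 = ssum d Finset.univ x := by
      simp [ssum]
    rw [e]
    have h1 : (1:ℝ) ≤ n * ww d x := by
      refine le_trans hx (mul_le_mul_of_nonneg_left ?_ (by positivity))
      nlinarith [rr_le_one (ℓ := ℓ) x, ww_pos x]
    have h0 := ssum_nonneg Finset.univ x
    unfold ww at h1
    rw [← div_eq_mul_inv, le_div_iff₀ (by positivity)] at h1
    linarith
  have hcpt : HasCompactSupport (cut d ℓ c n) :=
    (isCompact_closedBall (0 : Ed d) (Real.sqrt n)).of_isClosed_subset (isClosed_tsupport _)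
      (hsup.trans hAb)
  refine ⟨?_, hcpt, hsup.trans hAΩ⟩
  rw [contDiff_iff_contDiffAt]
  intro x
  by_cases hx : x ∈ A
  · have hr : rr d ℓ x ≠ 0 := (rr_pos (hAΩ hx)).ne'
    exact ((rr_smooth d ℓ).contDiffAt.rpow_const_of_ne hr).mul (kap_smooth.comp hsm).contDiffAt
  · have : cut d ℓ c n =ᶠ[𝓝 x] fun _ => 0 := by
      filter_upwards [hAc.isOpen_compl.mem_nhds hx] with y hy
      have : (n:ℝ) * (rr d ℓ y * ww d y) ≤ 1 := le_of_not_ge (fun h => hy h)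
      simp [cut, kap_zero this]
    exact contDiffAt_const.congr_of_eventuallyEq this

lemma cut_deriv (d ℓ : ℕ) (c : ℝ) : ∃ C : ℝ, 0 < C ∧ ∀ n i, ∀ x ∈ ModelDomain d ℓ,
    |pderivI d i (cut d ℓ c n) x| ≤ C * rr d ℓ x ^ ((c - 1) / 2) := by
  obtain ⟨Ck, hCk, hk⟩ := kap_deriv
  refine ⟨|c| + 3 * Ck, by positivity, fun n i x hx => ?_⟩
  obtain ⟨r', hr', br⟩ := rr_LD (ℓ := ℓ) i x
  obtain ⟨w', hw', bw⟩ := ww_LD i x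
  have hr := rr_pos hx
  have hr1 := rr_le_one (ℓ := ℓ) x
  have hw := ww_pos x
  have hA : HasDerivAt _ _ (0:ℝ) := HasDerivAt.rpow_const (p := c / 2) hr' (Or.inl (by
    simp only [zero_smul, add_zero]; exact hr.ne'))
  have hH : HasDerivAt _ _ (0:ℝ) := (HasDerivAt.mul hr' hw').const_mul (n:ℝ)
  have hK := ((kap_smooth.differentiable (by simp) _).hasDerivAt).comp (0:ℝ) hH
  have hP := HasDerivAt.mul hA hK
  have hLD : LD d i (cut d ℓ c n) _ x := hP
  rw [hLD.pderivI (cut_test d ℓ c n).1]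
  simp only [zero_smul, add_zero, Pi.mul_apply, Function.comp_apply]
  set r := rr d ℓ x
  set w := ww d x
  set k' := deriv kap (n * (r * w)) with hk'
  have hkk := hk (n * (r * w))
  rw [← hk'] at hkk
  set k := kap (n * (r * w)) with hkdef
  have hk0 : 0 ≤ k := kap_nonneg _
  have hk1 : k ≤ 1 := kap_le_one _
  have hsq : Real.sqrt r = r ^ ((1:ℝ)/2) := Real.sqrt_eq_rpow r
  have t1 : |r' * (c / 2) * r ^ (c / 2 - 1) * k| ≤ |c| * r ^ ((c - 1) / 2) := by
    rw [abs_mul, abs_mul, abs_mul, abs_of_nonneg hk0, abs_of_pos (Real.rpow_pos_of_pos hr _),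
      abs_div, abs_two]
    have e : r ^ ((c - 1) / 2) = Real.sqrt r * r ^ (c / 2 - 1) := by
      rw [hsq, ← Real.rpow_add hr]; congr 1; ring
    rw [e]
    have hp := Real.rpow_pos_of_pos hr (c / 2 - 1)
    calc |r'| * (|c| / 2) * r ^ (c / 2 - 1) * k ≤ (2 * Real.sqrt r) * (|c| / 2) * r ^ (c / 2 - 1) * 1 := by
          gcongr
      _ = _ := by ring
  have hh : |r' * w + r * w'| ≤ 3 * Real.sqrt r * w := by
    have hrs : r ≤ Real.sqrt r := Real.le_sqrt_of_sq_le (by nlinarith)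
    calc |r' * w + r * w'| ≤ |r'| * w + r * |w'| := by
          refine (abs_add_le _ _).trans ?_
          rw [abs_mul, abs_mul, abs_of_pos hw, abs_of_pos hr]
      _ ≤ (2 * Real.sqrt r) * w + Real.sqrt r * w := by gcongr
      _ = _ := by ring
  have t2 : |r ^ (c / 2) * (k' * (n * (r' * w + r * w')))| ≤ 3 * Ck * r ^ ((c - 1) / 2) := by
    rw [abs_mul, abs_mul, abs_mul, abs_of_pos (Real.rpow_pos_of_pos hr _),
      abs_of_nonneg (Nat.cast_nonneg n : (0:ℝ) ≤ n)]
    have e : r ^ (c / 2) * Real.sqrt r = r ^ ((c - 1) / 2) * r := by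
      rw [hsq, ← Real.rpow_add hr]
      nth_rewrite 3 [← Real.rpow_one r]
      rw [← Real.rpow_add hr]; congr 1; ring
    have hp := Real.rpow_pos_of_pos hr (c / 2)
    have hp' := Real.rpow_pos_of_pos hr ((c - 1) / 2)
    have hkk' : |k'| * (n * (r * w)) ≤ Ck := by
      rw [abs_mul, abs_of_nonneg (by positivity : (0:ℝ) ≤ n * (r * w))] at hkk
      exact hkk
    calc r ^ (c / 2) * (|k'| * (n * |r' * w + r * w'|))
        ≤ r ^ (c / 2) * (|k'| * (n * (3 * Real.sqrt r * w))) := by gcongr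
      _ = 3 * (r ^ (c / 2) * Real.sqrt r) * |k'| * n * w := by ring
      _ = 3 * (|k'| * (n * (r * w))) * r ^ ((c - 1) / 2) := by rw [e]; ring
      _ ≤ _ := by gcongr
  calc _ ≤ _ := abs_add_le _ _
    _ ≤ |c| * r ^ ((c - 1) / 2) + 3 * Ck * r ^ ((c - 1) / 2) := add_le_add t1 t2
    _ = _ := by ring

theorem cutoff (d ℓ : ℕ) (c : ℝ) : ∃ C : ℝ, 0 < C ∧ ∃ (φ : ℕ → Ed d → ℝ) (Φ : Ed d → ℝ),
    (∀ n, IsTestFun d (ModelDomain d ℓ) (φ n)) ∧ ∀ x ∈ ModelDomain d ℓ,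
      (∀ n, |φ n x| ≤ C * rhoModel d ℓ x ^ c) ∧
      (∀ n i, |pderivI d i (φ n) x| ≤ C * rhoModel d ℓ x ^ (c - 1)) ∧
      Tendsto (fun n => φ n x) atTop (𝓝 (Φ x)) ∧ rhoModel d ℓ x ^ c ≤ C * |Φ x| := by
  obtain ⟨C1, hC1, h1⟩ := rho_rr d ℓ c
  obtain ⟨C2, hC2, h2⟩ := rho_rr d ℓ (c - 1)
  obtain ⟨C3, hC3, h3⟩ := cut_deriv d ℓ c
  refine ⟨max C1 (C3 * C2), by positivity, cut d ℓ c, fun x => rr d ℓ x ^ (c / 2),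
    cut_test d ℓ c, fun x hx => ?_⟩
  have hρ := rho_pos hx
  have hr := rr_pos hx
  have hw := ww_pos x
  have hρc := Real.rpow_pos_of_pos hρ c
  have hρc1 := Real.rpow_pos_of_pos hρ (c - 1)
  have hrc := Real.rpow_pos_of_pos hr (c / 2)
  refine ⟨fun n => ?_, fun n i => ?_, ?_, ?_⟩
  · unfold cut
    rw [abs_mul, abs_of_pos hrc, abs_of_nonneg (kap_nonneg _)]
    calc rr d ℓ x ^ (c / 2) * kap (n * (rr d ℓ x * ww d x)) ≤ rr d ℓ x ^ (c / 2) * 1 := by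
          gcongr; exact kap_le_one _
      _ ≤ C1 * rhoModel d ℓ x ^ c := by rw [mul_one]; exact (h1 x hx).1
      _ ≤ _ := by gcongr; exact le_max_left _ _
  · calc _ ≤ C3 * rr d ℓ x ^ ((c - 1) / 2) := h3 n i x hx
      _ ≤ C3 * (C2 * rhoModel d ℓ x ^ (c - 1)) := by gcongr; exact (h2 x hx).1
      _ = (C3 * C2) * rhoModel d ℓ x ^ (c - 1) := by ring
      _ ≤ _ := by gcongr; exact le_max_right _ _
  · have hlim : Tendsto (fun n : ℕ => (n:ℝ) * (rr d ℓ x * ww d x)) atTop atTop :=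
      tendsto_natCast_atTop_atTop.atTop_mul_const (by positivity)
    refine tendsto_const_nhds.congr' ?_
    filter_upwards [hlim.eventually_ge_atTop 2] with n hn
    simp [cut, kap_one hn]
  · rw [abs_of_pos hrc]
    refine (h1 x hx).2.trans ?_
    gcongr; exact le_max_left _ _

end Kon

namespace Kon

/-- weighted norm -/
def NN (d ℓ : ℕ) (b : ℝ) (q : ℝ≥0∞) (f : Ed d → ℝ) : ℝ≥0∞ :=
  eLpNorm (fun x => rhoModel d ℓ x ^ b * f x) q (volume.restrict (ModelDomain d ℓ))

lemma wt_meas {d ℓ : ℕ} (b : ℝ) {f : Ed d → ℝ}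
    (hf : LocallyIntegrableOn f (ModelDomain d ℓ) volume) :
    AEStronglyMeasurable (fun x => rhoModel d ℓ x ^ b * f x)
      (volume.restrict (ModelDomain d ℓ)) :=
  ((rho_cont d ℓ).measurable.pow_const b).aestronglyMeasurable.mul hf.aestronglyMeasurable

lemma wt_local {d ℓ : ℕ} {b : ℝ} {q : ℝ≥0∞} {f : Ed d → ℝ}
    (hf : LocallyIntegrableOn f (ModelDomain d ℓ) volume) (h : NN d ℓ b q f < ⊤) :
    LL d (ModelDomain d ℓ) q f := by
  intro K hK hKΩ
  have h1 : ContinuousOn (fun x => rhoModel d ℓ x ^ (-b)) K :=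
    (rho_cont d ℓ).continuousOn.rpow_const fun x hx => Or.inl (rho_pos (hKΩ hx)).ne'
  obtain ⟨C, hC⟩ := hK.exists_bound_of_continuousOn h1
  have h2 : MemLp (fun x => rhoModel d ℓ x ^ b * f x) q (volume.restrict K) :=
    (show MemLp _ q (volume.restrict (ModelDomain d ℓ)) from
      ⟨wt_meas b hf, h⟩).mono_measure (Measure.restrict_mono hKΩ le_rfl)
  refine h2.of_le_mul (c := C) (hf.aestronglyMeasurable.mono_measure
    (Measure.restrict_mono hKΩ le_rfl)) ?_
  filter_upwards [ae_restrict_mem hK.measurableSet] with x hx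
  have hρ := rho_pos (hKΩ hx)
  have e : f x = rhoModel d ℓ x ^ (-b) * (rhoModel d ℓ x ^ b * f x) := by
    rw [← mul_assoc, ← Real.rpow_add hρ]
    simp
  calc ‖f x‖ = ‖rhoModel d ℓ x ^ (-b)‖ * ‖rhoModel d ℓ x ^ b * f x‖ := by
        rw [← norm_mul, ← e]
    _ ≤ _ := mul_le_mul_of_nonneg_right (hC x hx) (norm_nonneg _)

lemma sobolev_step {d : ℕ} (ℓ : ℕ) (hd : 0 < d) {q q' : ℝ≥0} (hq : 1 ≤ q)
    (hq' : (q' : ℝ)⁻¹ = (q : ℝ)⁻¹ - (d : ℝ)⁻¹) (b : ℝ) :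
    ∃ C : ℝ≥0, ∀ (f : Ed d → ℝ) (fi : Fin d → Ed d → ℝ),
      (∀ i, WD d (ModelDomain d ℓ) i f (fi i)) → NN d ℓ b q f < ⊤ →
      (∀ i, NN d ℓ (b + 1) q (fi i) < ⊤) →
      NN d ℓ (b + 1) q' f ≤ C * (NN d ℓ b q f + ∑ i, NN d ℓ (b + 1) q (fi i)) := by
  obtain ⟨C, hC, φ, Φ, hφ, hb⟩ := cutoff d ℓ (b + 1)
  set S : ℝ≥0 := SNormLESNormFDerivOfEqConst ℝ (volume : Measure (Ed d)) q with hS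
  set Ω := ModelDomain d ℓ with hΩ
  have hΩm : MeasurableSet Ω := (dom_open d ℓ).measurableSet
  refine ⟨C.toNNReal * (S * (C.toNNReal * (d + 1))), fun f fi hW hf hfi => ?_⟩
  have hfl : LocallyIntegrableOn f Ω volume := (hW ⟨0, hd⟩).1
  have hLf := wt_local hfl hf
  have hLfi := fun i => wt_local (hW i).2.1 (hfi i)
  have hsupp : ∀ n i, Function.support (fun x => fi i x * φ n x + f x * pderivI d i (φ n) x) ⊆ Ω := by
    intro n i x hx
    by_contra hxΩ
    apply hx
    have h1 : φ n x = 0 := image_eq_zero_of_notMem_tsupport fun h => hxΩ ((hφ n).2.2 h)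
    have h2 : pderivI d i (φ n) x = 0 :=
      image_eq_zero_of_notMem_tsupport fun h => hxΩ ((test_pderivI (hφ n) i).2.2 h)
    simp [h1, h2]
  have hG : ∀ n i, eLpNorm (fun x => fi i x * φ n x + f x * pderivI d i (φ n) x) q volume ≤
      ENNReal.ofReal C * (NN d ℓ (b+1) q (fi i) + NN d ℓ b q f) := by
    intro n i
    rw [← eLpNorm_restrict_eq_of_support_subset (hsupp n i)]
    have m1 : AEStronglyMeasurable (fun x => fi i x * φ n x) (volume.restrict Ω) :=
      (hW i).2.1.aestronglyMeasurable.mul (hφ n).1.continuous.aestronglyMeasurable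
    have m2 : AEStronglyMeasurable (fun x => f x * pderivI d i (φ n) x) (volume.restrict Ω) :=
      hfl.aestronglyMeasurable.mul (test_pderivI (hφ n) i).1.continuous.aestronglyMeasurable
    refine (eLpNorm_add_le m1 m2 (by exact_mod_cast hq)).trans ?_
    rw [mul_add]
    refine add_le_add ?_ ?_
    · refine eLpNorm_le_mul_eLpNorm_of_ae_le_mul ?_ _
      filter_upwards [ae_restrict_mem hΩm] with x hx
      have h1 := (hb x hx).1 n
      have hρ := Real.rpow_nonneg (rho_pos hx).le (b+1)
      rw [norm_mul, norm_mul, Real.norm_of_nonneg hρ, mul_comm ‖fi i x‖, ← mul_assoc]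
      exact mul_le_mul_of_nonneg_right h1 (norm_nonneg _)
    · refine eLpNorm_le_mul_eLpNorm_of_ae_le_mul ?_ _
      filter_upwards [ae_restrict_mem hΩm] with x hx
      have h1 := (hb x hx).2.1 n i
      have hρ := Real.rpow_nonneg (rho_pos hx).le b
      rw [add_sub_cancel_right] at h1
      rw [norm_mul, norm_mul, Real.norm_of_nonneg hρ, mul_comm ‖f x‖, ← mul_assoc]
      exact mul_le_mul_of_nonneg_right h1 (norm_nonneg _)
  have hn : ∀ n, eLpNorm (fun x => f x * φ n x) q' (volume.restrict Ω) ≤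
      S * (ENNReal.ofReal C * ((d + 1) * (NN d ℓ b q f + ∑ i, NN d ℓ (b + 1) q (fi i)))) := by
    intro n
    refine (eLpNorm_mono_measure _ Measure.restrict_le_self).trans ?_
    have hcs : HasCompactSupport (fun x => f x * φ n x) := (hφ n).2.1.mul_left
    refine (gns hd hq hq' hcs (G := fun i x => fi i x * φ n x + f x * pderivI d i (φ n) x)
      (fun i => ((hLfi i).test (hφ n)).add (hLf.test (test_pderivI (hφ n) i)))
      (fun i => (hW i).localize (hφ n))).trans ?_
    refine mul_le_mul_right ?_ _
    refine (Finset.sum_le_sum fun i _ => hG n i).trans ?_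
    rw [← Finset.mul_sum]
    refine mul_le_mul_right ?_ _
    rw [Finset.sum_add_distrib]
    simp only [Finset.sum_const, Finset.card_univ, Fintype.card_fin, nsmul_eq_mul]
    rw [mul_add, add_comm, add_mul, add_mul, one_mul, one_mul]
    exact add_le_add le_self_add le_add_self
  have hlim : eLpNorm (fun x => f x * Φ x) q' (volume.restrict Ω) ≤
      S * (ENNReal.ofReal C * ((d + 1) * (NN d ℓ b q f + ∑ i, NN d ℓ (b + 1) q (fi i)))) := by
    refine (Lp.eLpNorm_lim_le_liminf_eLpNorm (f := fun n x => f x * φ n x) (fun n =>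
      hfl.aestronglyMeasurable.mul (hφ n).1.continuous.aestronglyMeasurable) _ ?_).trans ?_
    · filter_upwards [ae_restrict_mem hΩm] with x hx
      exact (hb x hx).2.2.1.const_mul _
    · exact liminf_le_of_frequently_le' (Eventually.of_forall hn).frequently
  have hfin : NN d ℓ (b+1) q' f ≤
      ENNReal.ofReal C * eLpNorm (fun x => f x * Φ x) q' (volume.restrict Ω) := by
    refine eLpNorm_le_mul_eLpNorm_of_ae_le_mul ?_ _
    filter_upwards [ae_restrict_mem hΩm] with x hx
    have h1 := (hb x hx).2.2.2
    have hρ := Real.rpow_nonneg (rho_pos hx).le (b+1)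
    rw [norm_mul, norm_mul, Real.norm_of_nonneg hρ, mul_comm ‖f x‖, ← mul_assoc]
    exact mul_le_mul_of_nonneg_right h1 (norm_nonneg _)
  refine (hfin.trans (mul_le_mul_right hlim _)).trans (le_of_eq ?_)
  have : ENNReal.ofReal C = (C.toNNReal : ℝ≥0∞) := rfl
  rw [this]
  push_cast
  ring

end Kon

namespace Kon

/-- Sobolev exponents: `1 / pe = 1/p - j/d` -/
def pe (d : ℕ) (p : ℝ) (j : ℕ) : ℝ≥0 := ((1 / p - j / d)⁻¹).toNNReal

lemma pe_aux {d m : ℕ} {p : ℝ} (hd : 0 < d) (h2 : (m : ℝ) < d / p) {j : ℕ}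
    (hj : j ≤ m) : 0 < 1 / p - (j:ℝ) / d := by
  have hd' : (0:ℝ) < d := by exact_mod_cast hd
  have : (j:ℝ) < d / p := lt_of_le_of_lt (by exact_mod_cast hj) h2
  have h3 : (j:ℝ) / d < (d / p) / d := div_lt_div_of_pos_right this hd'
  have h4 : ((d:ℝ) / p) / d = 1 / p := by
    rw [div_div, mul_comm, ← div_div, div_self hd'.ne']
  linarith

lemma pe_inv {d m : ℕ} {p : ℝ} (hd : 0 < d) (h2 : (m : ℝ) < d / p) {j : ℕ}
    (hj : j ≤ m) : (pe d p j : ℝ)⁻¹ = 1 / p - (j:ℝ) / d := by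
  have := pe_aux hd h2 hj
  rw [pe, Real.coe_toNNReal _ (inv_nonneg.2 this.le), inv_inv]

lemma pe_one {d m : ℕ} {p : ℝ} (hd : 0 < d) (hp : 1 < p) (h2 : (m : ℝ) < d / p) {j : ℕ}
    (hj : j ≤ m) : 1 ≤ pe d p j := by
  have h := pe_aux hd h2 hj
  have : (1:ℝ) ≤ pe d p j := by
    rw [pe, Real.coe_toNNReal _ (inv_nonneg.2 h.le)]
    apply (one_le_inv₀ h).2
    have : 1 / p ≤ 1 := by
      rw [div_le_one (by linarith)]
      exact hp.le
    have : (0:ℝ) ≤ (j:ℝ) / d := by positivity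
    linarith
  exact_mod_cast this

lemma pe_zero {d : ℕ} {p : ℝ} (hp : 1 < p) : (pe d p 0 : ℝ) = p := by
  rw [pe]
  simp
  linarith

lemma k_eq {d ℓ : ℕ} {a : ℝ} {α : Fin d → ℕ} {q : ℝ} (f : Ed d → ℝ) :
    kIntegrand d (rhoModel d ℓ) a q α f =
      fun x => ‖rhoModel d ℓ x ^ (((∑ i, α i : ℕ) : ℝ) - a) * f x‖ ^ q := by
  funext x
  rw [kIntegrand, norm_mul, Real.norm_of_nonneg (Real.rpow_nonneg (rho_nonneg x) _), Real.norm_eq_abs]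

lemma k_int {d ℓ : ℕ} {a : ℝ} {α : Fin d → ℕ} {q : ℝ≥0} (hq : q ≠ 0) {f : Ed d → ℝ}
    (hf : LocallyIntegrableOn f (ModelDomain d ℓ) volume) :
    IntegrableOn (kIntegrand d (rhoModel d ℓ) a q α f) (ModelDomain d ℓ) volume ↔
      NN d ℓ (((∑ i, α i : ℕ) : ℝ) - a) q f < ⊤ := by
  rw [k_eq, IntegrableOn]
  have := integrable_norm_rpow_iff (p := (q : ℝ≥0∞)) (wt_meas (((∑ i, α i : ℕ) : ℝ) - a) hf)
    (by exact_mod_cast hq) ENNReal.coe_ne_top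
  rw [ENNReal.coe_toReal] at this
  rw [this]
  exact ⟨fun h => h.2, fun h => ⟨wt_meas _ hf, h⟩⟩

lemma k_norm {d ℓ : ℕ} {a : ℝ} {α : Fin d → ℕ} {q : ℝ≥0} (hq : q ≠ 0) {f : Ed d → ℝ}
    (hf : LocallyIntegrableOn f (ModelDomain d ℓ) volume)
    (h : NN d ℓ (((∑ i, α i : ℕ) : ℝ) - a) q f < ⊤) :
    NN d ℓ (((∑ i, α i : ℕ) : ℝ) - a) q f = ENNReal.ofReal
      ((∫ x in ModelDomain d ℓ, kIntegrand d (rhoModel d ℓ) a q α f x) ^ (q : ℝ)⁻¹) := by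
  rw [k_eq, NN, MemLp.eLpNorm_eq_integral_rpow_norm (by exact_mod_cast hq) ENNReal.coe_ne_top
    ⟨wt_meas _ hf, h⟩, ENNReal.coe_toReal]

lemma k_nonneg {d ℓ : ℕ} {a : ℝ} {α : Fin d → ℕ} {q : ℝ} (f : Ed d → ℝ) :
    0 ≤ ∫ x in ModelDomain d ℓ, kIntegrand d (rhoModel d ℓ) a q α f x := by
  rw [k_eq]
  exact integral_nonneg fun x => Real.rpow_nonneg (norm_nonneg _) _

/-- iterated weighted Sobolev embedding -/
lemma iter {d m : ℕ} (ℓ : ℕ) {p : ℝ} (hd : 0 < d) (hp : 1 < p) (h2 : (m : ℝ) < d / p) (a : ℝ)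
    (j : ℕ) : ∀ k, k + j ≤ m → ∃ C : ℝ≥0, ∀ u D,
      KMemData d (ModelDomain d ℓ) (rhoModel d ℓ) m a p u D → ∀ α : Fin d → ℕ, ∑ i, α i = k →
      NN d ℓ (k + j - a) (pe d p j) (D α) ≤
        C * ENNReal.ofReal (KnormP d (ModelDomain d ℓ) (rhoModel d ℓ) m a p D) := by
  induction j with
  | zero =>
    intro k hk
    refine ⟨1, fun u D hD α hα => ?_⟩
    have hαm : α ∈ multiIdx d m := mem_multiIdx.2 (by omega)
    have hq : pe d p 0 ≠ 0 := (lt_of_lt_of_le one_pos (pe_one hd hp h2 (Nat.zero_le m))).ne'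
    have hloc := (hD.1 α hαm).2.1
    have hint := hD.2 α hαm
    have hpz := pe_zero (d := d) hp
    conv at hint => rw [← hpz]
    have hfin := (k_int hq hloc).1 hint
    have hn := k_norm hq hloc hfin
    rw [hpz, hα] at hn
    simp only [Nat.cast_zero, add_zero, ENNReal.coe_one, one_mul]
    rw [hn, KnormP, one_div]
    refine ENNReal.ofReal_le_ofReal (Real.rpow_le_rpow (k_nonneg _) ?_ (by positivity))
    exact Finset.single_le_sum
      (f := fun α => ∫ x in ModelDomain d ℓ, kIntegrand d (rhoModel d ℓ) a p α (D α) x)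
      (fun _ _ => k_nonneg _) hαm
  | succ j ih =>
    intro k hk
    obtain ⟨C1, h1⟩ := ih k (by omega)
    obtain ⟨C2, h3⟩ := ih (k+1) (by omega)
    obtain ⟨C, hC⟩ := sobolev_step ℓ hd (q := pe d p j) (q' := pe d p (j+1))
      (pe_one hd hp h2 (by omega)) (by
        rw [pe_inv hd h2 (by omega), pe_inv hd h2 (by omega)]
        push_cast
        ring) (k + j - a)
    refine ⟨C * (C1 + d * C2), fun u D hD α hα => ?_⟩
    have hαm : α ∈ multiIdx d m := mem_multiIdx.2 (by omega)
    have hαi : ∀ i, ∑ l, (α + Pi.single i 1 : Fin d → ℕ) l = k + 1 := fun i => by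
      rw [sum_add_single, hα]
    have hαim : ∀ i, (α + Pi.single i 1 : Fin d → ℕ) ∈ multiIdx d m := fun i =>
      mem_multiIdx.2 (by rw [hαi]; omega)
    have e1 := h1 u D hD α hα
    have e2 : ∀ i, NN d ℓ (k + j - a + 1) (pe d p j) (D (α + Pi.single i 1)) ≤
        C2 * ENNReal.ofReal (KnormP d (ModelDomain d ℓ) (rhoModel d ℓ) m a p D) := fun i => by
      have := h3 u D hD _ (hαi i)
      convert this using 2
      push_cast
      ring
    have := hC (D α) (fun i => D (α + Pi.single i 1))
      (fun i => weak_step (hD.1 α hαm) (hD.1 _ (hαim i)))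
      (e1.trans_lt (ENNReal.mul_lt_top ENNReal.coe_lt_top ENNReal.ofReal_lt_top))
      (fun i => (e2 i).trans_lt (ENNReal.mul_lt_top ENNReal.coe_lt_top ENNReal.ofReal_lt_top))
    have e3 : ((k:ℝ) + ((j+1:ℕ):ℝ) - a) = k + j - a + 1 := by push_cast; ring
    rw [e3]
    refine this.trans ?_
    push_cast
    rw [mul_assoc, add_mul]
    refine mul_le_mul_right (add_le_add e1 ?_) _
    refine (Finset.sum_le_sum fun i _ => e2 i).trans ?_
    simp [mul_assoc]

lemma conj_exists {a b : ℝ≥0} (ha : 1 ≤ a) (hb : 1 ≤ b) (h : (a:ℝ)⁻¹ + (b:ℝ)⁻¹ ≤ 1) :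
    ∃ a' : ℝ≥0∞, ENNReal.HolderConjugate a' a ∧ a' ≤ b := by
  have ha0 : a ≠ 0 := (lt_of_lt_of_le one_pos ha).ne'
  have hb0 : b ≠ 0 := (lt_of_lt_of_le one_pos hb).ne'
  have hle : (a:ℝ≥0∞)⁻¹ ≤ 1 := ENNReal.inv_le_one.2 (by exact_mod_cast ha)
  refine ⟨(1 - (a:ℝ≥0∞)⁻¹)⁻¹, ⟨?_⟩, ?_⟩
  · rw [inv_inv, inv_one, tsub_add_cancel_of_le hle]
  · rw [ENNReal.inv_le_iff_inv_le]
    apply ENNReal.le_sub_of_add_le_right (by simp [ha0])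
    rw [← ENNReal.coe_inv ha0, ← ENNReal.coe_inv hb0]
    have : b⁻¹ + a⁻¹ ≤ 1 := by
      rw [add_comm]
      exact_mod_cast h
    exact_mod_cast this

lemma WD.add {d : ℕ} {Ω : Set (Ed d)} {i : Fin d} {f f' g g' : Ed d → ℝ} (h : WD d Ω i f f')
    (h' : WD d Ω i g g') : WD d Ω i (fun x => f x + g x) (fun x => f' x + g' x) := by
  refine ⟨h.1.add h'.1, h.2.1.add h'.2.1, fun φ hφ => ?_⟩
  simp only [add_mul]
  rw [integral_add (int_test h.1 (test_pderivI hφ i)) (int_test h'.1 (test_pderivI hφ i)),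
    integral_add (int_test h.2.1 hφ) (int_test h'.2.1 hφ), h.2.2 φ hφ, h'.2.2 φ hφ]
  ring

lemma WD.list {d : ℕ} {Ω : Set (Ed d)} {i : Fin d} {ι : Type} (L : List ι)
    (F G : ι → Ed d → ℝ) (h : ∀ b ∈ L, WD d Ω i (F b) (G b)) :
    WD d Ω i (fun x => (L.map fun b => F b x).sum) (fun x => (L.map fun b => G b x).sum) := by
  induction L with
  | nil =>
    refine ⟨?_, ?_, fun φ _ => ?_⟩
    · simpa using (locallyIntegrable_const (0:ℝ)).locallyIntegrableOn Ω
    · simpa using (locallyIntegrable_const (0:ℝ)).locallyIntegrableOn Ω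
    · simp
  | cons b L ih =>
    simp only [List.map_cons, List.sum_cons]
    exact (h b (by simp)).add (ih fun c hc => h c (by simp [hc]))

end Kon

namespace Kon

lemma LL_data {d m : ℕ} {ℓ : ℕ} {p : ℝ} (hd : 0 < d) (hp : 1 < p) (h2 : (m : ℝ) < d / p) {a : ℝ}
    {u : Ed d → ℝ} {D : (Fin d → ℕ) → Ed d → ℝ}
    (hD : KMemData d (ModelDomain d ℓ) (rhoModel d ℓ) m a p u D) (α : Fin d → ℕ) (j : ℕ)
    (h : ∑ i, α i + j ≤ m) : LL d (ModelDomain d ℓ) (pe d p j) (D α) := by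
  obtain ⟨C, hC⟩ := iter ℓ hd hp h2 a j _ h
  exact wt_local (hD.1 α (mem_multiIdx.2 (by omega))).2.1 ((hC u D hD α rfl).trans_lt
    (ENNReal.mul_lt_top ENNReal.coe_lt_top ENNReal.ofReal_lt_top))

lemma pe_sum {d m : ℕ} {p : ℝ} (hd : 0 < d) (h2 : (m : ℝ) < d / p) {j k : ℕ} (h : j + k = m) :
    (pe d p j : ℝ)⁻¹ + (pe d p k : ℝ)⁻¹ = 2 / p - m / d := by
  rw [pe_inv hd h2 (by omega), pe_inv hd h2 (by omega), ← h]
  push_cast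
  ring

lemma exp_le {d m : ℕ} {p : ℝ} (hd : 0 < d) (h1 : 2 * d * (1 / p - 1 / 2) < (m:ℝ)) :
    2 / p - (m:ℝ) / d ≤ 1 := by
  have hd' : (0:ℝ) < d := by exact_mod_cast hd
  have : 2 / p - (m:ℝ) / d = (2 * d * (1 / p) - m) / d := by
    field_simp
  rw [this, div_le_one hd']
  linarith

lemma sum_pi_add {d : ℕ} (β δ : Fin d → ℕ) : ∑ i, (β + δ) i = ∑ i, β i + ∑ i, δ i := by
  simp [Finset.sum_add_distrib]

lemma leibniz {d m : ℕ} (ℓ : ℕ) {p : ℝ} (hd : 0 < d) (hp : 1 < p)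
    (h1 : 2 * d * (1 / p - 1 / 2) < (m:ℝ)) (h2 : (m : ℝ) < d / p) (a : ℝ) (n : ℕ) :
    n ≤ m → ∀ γ : Fin d → ℕ, ∑ i, γ i = n →
    ∃ L : List ((Fin d → ℕ) × (Fin d → ℕ)), (∀ b ∈ L, b.1 + b.2 = γ) ∧
      ∀ u v Du Dv, KMemData d (ModelDomain d ℓ) (rhoModel d ℓ) m a p u Du →
        KMemData d (ModelDomain d ℓ) (rhoModel d ℓ) m a p v Dv →
        HasWeakDerivOn d (ModelDomain d ℓ) γ (u * v)
          (fun x => (L.map fun b => Du b.1 x * Dv b.2 x).sum) := by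
  have hexp := exp_le hd h1
  have hΩ := dom_open d ℓ
  induction n with
  | zero =>
    intro _ γ hγ
    have hγ0 : γ = 0 := by
      funext i
      have := Finset.sum_eq_zero_iff.1 hγ i (Finset.mem_univ i)
      simpa using this
    subst hγ0
    refine ⟨[(0, 0)], by simp, fun u v Du Dv hu hv => ?_⟩
    simp only [List.map_cons, List.map_nil, List.sum_cons, List.sum_nil, add_zero]
    have h0 : (0 : Fin d → ℕ) ∈ multiIdx d m := mem_multiIdx.2 (by simp)
    have key : ∀ w Dw, KMemData d (ModelDomain d ℓ) (rhoModel d ℓ) m a p w Dw →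
        Dw 0 =ᵐ[volume.restrict (ModelDomain d ℓ)] w := by
      intro w Dw hw
      have hw0 := hw.1 0 h0
      refine weak_unique hΩ hw0 ⟨hw0.1, hw0.1, fun φ hφ => ?_⟩
      simp [pderivA_zero]
    have L1 := LL_data hd hp h2 hu 0 m (by simp)
    have L2 := LL_data hd hp h2 hv 0 0 (by simp)
    obtain ⟨a', ha', hle⟩ := conj_exists (pe_one hd hp h2 (le_refl m)) (pe_one hd hp h2 (Nat.zero_le m))
      ((pe_sum hd h2 (by omega)).le.trans hexp)
    have hloc := L1.locInt_mul hΩ (L2.mono hle)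
    have hae : (fun x => Du 0 x * Dv 0 x) =ᵐ[volume.restrict (ModelDomain d ℓ)] u * v := by
      filter_upwards [key u Du hu, key v Dv hv] with x hx hy
      simp [hx, hy]
    refine ⟨hloc.congr hae, hloc, fun φ hφ => ?_⟩
    rw [pderivA_zero]
    simp only [Pi.zero_apply, Finset.sum_const_zero, pow_zero, one_mul]
    refine integral_congr_ae ?_
    filter_upwards [hae] with x hx
    rw [← hx]
  | succ n ih =>
    intro hn γ hγ
    obtain ⟨i, hi⟩ : ∃ i, γ i ≠ 0 := by
      by_contra hcon
      push Not at hcon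
      simp [hcon] at hγ
    obtain ⟨γ', rfl⟩ : ∃ γ' : Fin d → ℕ, γ = γ' + Pi.single i 1 := by
      refine ⟨fun j => γ j - (Pi.single i 1 : Fin d → ℕ) j, ?_⟩
      funext j
      by_cases hj : j = i
      · subst hj
        change γ j = γ j - (Pi.single j 1 : Fin d → ℕ) j + (Pi.single j 1 : Fin d → ℕ) j
        rw [Pi.single_eq_same]
        omega
      · change γ j = γ j - (Pi.single i 1 : Fin d → ℕ) j + (Pi.single i 1 : Fin d → ℕ) j
        rw [Pi.single_eq_of_ne hj]
        omega
    rw [sum_add_single] at hγ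
    obtain ⟨L, hL, hD⟩ := ih (by omega) γ' (by omega)
    refine ⟨(L.map fun b => (b.1 + Pi.single i 1, b.2)) ++ (L.map fun b => (b.1, b.2 + Pi.single i 1)),
      ?_, fun u v Du Dv hu hv => ?_⟩
    · intro b hb
      rw [List.mem_append, List.mem_map, List.mem_map] at hb
      rcases hb with ⟨c, hc, rfl⟩ | ⟨c, hc, rfl⟩
      · rw [← hL c hc]
        exact add_right_comm _ _ _
      · rw [← hL c hc]
        exact (add_assoc _ _ _).symm
    · refine weak_build (hD u v Du Dv hu hv) ?_
      have := WD.list L (Ω := ModelDomain d ℓ) (i := i) (fun b x => Du b.1 x * Dv b.2 x)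
        (fun b x => Du (b.1 + Pi.single i 1) x * Dv b.2 x + Du b.1 x * Dv (b.2 + Pi.single i 1) x) ?_
      · convert this using 2 with x
        simp only [List.map_append, List.map_map, List.sum_append, List.sum_map_add]
        rfl
      · intro b hb
        have hs : ∑ l, b.1 l + ∑ l, b.2 l = n := by
          rw [← sum_pi_add, hL b hb]
          omega
        set s := ∑ l, b.1 l with hsdef
        have c1 : ∑ l, (b.1 + Pi.single i 1 : Fin d → ℕ) l = s + 1 := sum_add_single ..
        have c2 : ∑ l, (b.2 + Pi.single i 1 : Fin d → ℕ) l = ∑ l, b.2 l + 1 := sum_add_single ..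
        have W1 : WD d (ModelDomain d ℓ) i (Du b.1) (Du (b.1 + Pi.single i 1)) :=
          weak_step (hu.1 _ (mem_multiIdx.2 (by omega))) (hu.1 _ (mem_multiIdx.2 (by omega)))
        have W2 : WD d (ModelDomain d ℓ) i (Dv b.2) (Dv (b.2 + Pi.single i 1)) :=
          weak_step (hv.1 _ (mem_multiIdx.2 (by omega))) (hv.1 _ (mem_multiIdx.2 (by omega)))
        have p1 := pe_one hd hp h2 (show m - s - 1 ≤ m by omega)
        have p2 := pe_one hd hp h2 (show s + 1 ≤ m by omega)
        have p3 := pe_one hd hp h2 (show m - s ≤ m by omega)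
        have p4 := pe_one hd hp h2 (show s ≤ m by omega)
        obtain ⟨a', ha', hle⟩ := conj_exists p1 p2
          ((pe_sum hd h2 (by omega)).le.trans hexp)
        obtain ⟨b', hb', hle'⟩ := conj_exists p3 p4
          ((pe_sum hd h2 (by omega)).le.trans hexp)
        exact product_rule hΩ W1 W2 p1 p3
          (LL_data hd hp h2 hu _ _ (by omega)) (LL_data hd hp h2 hu _ _ (by omega))
          ((LL_data hd hp h2 hv _ _ (by omega)).mono hle)
          (LL_data hd hp h2 hu _ _ (by omega)) ((LL_data hd hp h2 hv _ _ (by omega)).mono hle')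

lemma holder {d ℓ : ℕ} {q r t : ℝ≥0} (hq : 1 ≤ q) (hr : 1 ≤ r) (ht : t ≠ 0)
    (h : (q:ℝ)⁻¹ + (r:ℝ)⁻¹ = (t:ℝ)⁻¹) {b b1 b2 : ℝ} (hb : b1 + b2 ≤ b) {f g : Ed d → ℝ}
    (hf : LocallyIntegrableOn f (ModelDomain d ℓ) volume)
    (hg : LocallyIntegrableOn g (ModelDomain d ℓ) volume) :
    NN d ℓ b t (fun x => f x * g x) ≤ NN d ℓ b1 q f * NN d ℓ b2 r g := by
  have hq0 : q ≠ 0 := (lt_of_lt_of_le one_pos hq).ne'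
  have hr0 : r ≠ 0 := (lt_of_lt_of_le one_pos hr).ne'
  have : ENNReal.HolderTriple q r t := ⟨by
    rw [← ENNReal.coe_inv hq0, ← ENNReal.coe_inv hr0, ← ENNReal.coe_inv ht]
    exact_mod_cast h⟩
  refine le_trans ?_ (eLpNorm_smul_le_mul_eLpNorm (p := q) (q := r) (r := t) (wt_meas b2 hg) (wt_meas b1 hf))
  refine eLpNorm_mono_ae ?_
  filter_upwards [ae_restrict_mem (dom_open d ℓ).measurableSet] with x hx
  have hρ := rho_pos hx
  have h1 : rhoModel d ℓ x ^ b ≤ rhoModel d ℓ x ^ b1 * rhoModel d ℓ x ^ b2 := by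
    rw [← Real.rpow_add hρ]
    exact Real.rpow_le_rpow_of_exponent_ge hρ (rho_le_one x) hb
  have e : ((fun x => rhoModel d ℓ x ^ b1 * f x) • fun x => rhoModel d ℓ x ^ b2 * g x) x =
      (rhoModel d ℓ x ^ b1 * rhoModel d ℓ x ^ b2) * (f x * g x) := by
    simp only [Pi.smul_apply', smul_eq_mul]
    ring
  rw [e, norm_mul, norm_mul _ (f x * g x), Real.norm_of_nonneg (Real.rpow_nonneg hρ.le _),
    Real.norm_of_nonneg
      (mul_nonneg (Real.rpow_nonneg hρ.le b1) (Real.rpow_nonneg hρ.le b2))]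
  exact mul_le_mul_of_nonneg_right h1 (norm_nonneg _)

lemma NN_list {d ℓ : ℕ} {b : ℝ} {q : ℝ≥0} (hq : 1 ≤ q) {ι : Type} (L : List ι)
    (F : ι → Ed d → ℝ) (hF : ∀ c ∈ L, AEStronglyMeasurable (F c) (volume.restrict (ModelDomain d ℓ)))
    (C : ι → ℝ≥0) (K : ℝ≥0∞) (h : ∀ c ∈ L, NN d ℓ b q (F c) ≤ C c * K) :
    AEStronglyMeasurable (fun x => (L.map fun c => F c x).sum) (volume.restrict (ModelDomain d ℓ)) ∧
    NN d ℓ b q (fun x => (L.map fun c => F c x).sum) ≤ ((L.map C).sum : ℝ≥0) * K := by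
  induction L with
  | nil => 
    simp only [List.map_nil, List.sum_nil]
    refine ⟨aestronglyMeasurable_const, ?_⟩
    simp [NN]
  | cons c L ih =>
    obtain ⟨i1, i2⟩ := ih (fun c hc => hF c (by simp [hc])) (fun c hc => h c (by simp [hc]))
    simp only [List.map_cons, List.sum_cons]
    have hc := hF c (by simp)
    refine ⟨hc.add i1, ?_⟩
    have m0 : AEStronglyMeasurable (fun x => rhoModel d ℓ x ^ b)
      (volume.restrict (ModelDomain d ℓ)) :=
      ((rho_cont d ℓ).measurable.pow_const b).aestronglyMeasurable
    have := eLpNorm_add_le (m0.mul hc) (m0.mul i1) (p := q) (by exact_mod_cast hq)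
    push_cast
    rw [add_mul]
    refine le_trans ?_ (this.trans (add_le_add (h c (by simp)) i2))
    apply le_of_eq
    unfold NN
    congr 1
    funext x
    simp [mul_add]

lemma knorm_congr {d ℓ m : ℕ} {a p : ℝ} {u : Ed d → ℝ} {D E : (Fin d → ℕ) → Ed d → ℝ}
    (hD : KMemData d (ModelDomain d ℓ) (rhoModel d ℓ) m a p u D)
    (hE : KMemData d (ModelDomain d ℓ) (rhoModel d ℓ) m a p u E) :
    KnormP d (ModelDomain d ℓ) (rhoModel d ℓ) m a p D =
      KnormP d (ModelDomain d ℓ) (rhoModel d ℓ) m a p E := by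
  unfold KnormP
  congr 1
  refine Finset.sum_congr rfl fun α hα => integral_congr_ae ?_
  filter_upwards [weak_unique (dom_open d ℓ) (hD.1 α hα) (hE.1 α hα)] with x hx
  simp [kIntegrand, hx]

lemma knorm_nonneg {d ℓ m : ℕ} {a p : ℝ} (D : (Fin d → ℕ) → Ed d → ℝ) :
    0 ≤ KnormP d (ModelDomain d ℓ) (rhoModel d ℓ) m a p D :=
  Real.rpow_nonneg (Finset.sum_nonneg fun _ _ => k_nonneg _) _

/-- bound of one derivative of the product -/
lemma prod_bound {d m : ℕ} (ℓ : ℕ) {p : ℝ} (hd : 0 < d) (hp : 1 < p)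
    (h1 : 2 * d * (1 / p - 1 / 2) < (m:ℝ)) (h2 : (m : ℝ) < d / p) (a a₁ : ℝ) (ha : a₁ < 2 * a - m)
    {t : ℝ≥0} (ht : 1 ≤ t) (htinv : (t:ℝ)⁻¹ = 2 / p - m / d)
    (γ : Fin d → ℕ) (hγ : ∑ i, γ i ≤ m) :
    ∃ (L : List ((Fin d → ℕ) × (Fin d → ℕ))) (C : ℝ≥0),
      ∀ u v Du Dv, KMemData d (ModelDomain d ℓ) (rhoModel d ℓ) m a p u Du →
        KMemData d (ModelDomain d ℓ) (rhoModel d ℓ) m a p v Dv →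
        HasWeakDerivOn d (ModelDomain d ℓ) γ (u * v)
          (fun x => (L.map fun b => Du b.1 x * Dv b.2 x).sum) ∧
        NN d ℓ (((∑ i, γ i : ℕ) : ℝ) - a₁) t (fun x => (L.map fun b => Du b.1 x * Dv b.2 x).sum) ≤
          C * (ENNReal.ofReal (KnormP d (ModelDomain d ℓ) (rhoModel d ℓ) m a p Du) *
            ENNReal.ofReal (KnormP d (ModelDomain d ℓ) (rhoModel d ℓ) m a p Dv)) := by
  obtain ⟨L, hL, hD⟩ := leibniz ℓ hd hp h1 h2 a _ hγ γ rfl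
  have key : ∀ b : (Fin d → ℕ) × (Fin d → ℕ), ∃ C : ℝ≥0, b.1 + b.2 = γ →
      ∀ u v Du Dv, KMemData d (ModelDomain d ℓ) (rhoModel d ℓ) m a p u Du →
        KMemData d (ModelDomain d ℓ) (rhoModel d ℓ) m a p v Dv →
        NN d ℓ (((∑ i, γ i : ℕ) : ℝ) - a₁) t (fun x => Du b.1 x * Dv b.2 x) ≤
          C * (ENNReal.ofReal (KnormP d (ModelDomain d ℓ) (rhoModel d ℓ) m a p Du) *
            ENNReal.ofReal (KnormP d (ModelDomain d ℓ) (rhoModel d ℓ) m a p Dv)) := by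
    intro b
    by_cases hb : b.1 + b.2 = γ
    swap
    · exact ⟨0, fun h => absurd h hb⟩
    have hs : ∑ l, b.1 l + ∑ l, b.2 l = ∑ l, γ l := by
      rw [← sum_pi_add, hb]
    set s := ∑ l, b.1 l with hsdef
    obtain ⟨C1, hC1⟩ := iter ℓ hd hp h2 a (m - s) s (by omega)
    obtain ⟨C2, hC2⟩ := iter ℓ hd hp h2 a s (∑ l, b.2 l) (by omega)
    refine ⟨C1 * C2, fun _ u v Du Dv hu hv => ?_⟩
    have H := holder (ℓ := ℓ) (pe_one hd hp h2 (show m - s ≤ m by omega))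
      (pe_one hd hp h2 (show s ≤ m by omega)) (lt_of_lt_of_le one_pos ht).ne'
      ((pe_sum hd h2 (by omega)).trans htinv.symm)
      (b := ((∑ i, γ i : ℕ) : ℝ) - a₁) (b1 := s + ((m - s : ℕ) : ℝ) - a)
      (b2 := ((∑ l, b.2 l : ℕ) : ℝ) + s - a) ?_
      (hu.1 b.1 (mem_multiIdx.2 (by omega))).2.1 (hv.1 b.2 (mem_multiIdx.2 (by omega))).2.1
    · refine H.trans ((mul_le_mul' (hC1 u Du hu b.1 rfl) (hC2 v Dv hv b.2 rfl)).trans (le_of_eq ?_))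
      push_cast
      ring
    · rw [← hs, Nat.cast_sub (by omega)]
      push_cast
      linarith
  choose C hC using key
  refine ⟨L, (L.map C).sum, fun u v Du Dv hu hv => ⟨hD u v Du Dv hu hv, ?_⟩⟩
  refine (NN_list ht L (fun b x => Du b.1 x * Dv b.2 x) (fun c hc => ?_) C _ fun c hc =>
    hC c (hL c hc) u v Du Dv hu hv).2
  have hs : ∑ l, c.1 l + ∑ l, c.2 l = ∑ l, γ l := by
      rw [← sum_pi_add, hL c hc]
  exact (hu.1 c.1 (mem_multiIdx.2 (by omega))).2.1.aestronglyMeasurable.mul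
    (hv.1 c.2 (mem_multiIdx.2 (by omega))).2.1.aestronglyMeasurable

theorem main (d ℓ m : ℕ) (hd : 0 < d)
    (a₀ p : ℝ) (hp : 1 < p)
    (h1 : 2 * d * (1 / p - 1 / 2) < (m:ℝ)) (h2 : (m : ℝ) < d / p) (a₁ : ℝ) (ha : a₁ < 2 * a₀ - m) :
      ∃ c : ℝ, 0 < c ∧ ∀ u v : Ed d → ℝ,
        MemKM d ℓ m a₀ p u → MemKM d ℓ m a₀ p v →
        MemKM d ℓ m a₁ ((d : ℝ) / (2 * d / p - m)) (u * v) ∧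
        KnormM d ℓ m a₁ ((d : ℝ) / (2 * d / p - m)) (u * v) ≤
          c * KnormM d ℓ m a₀ p u * KnormM d ℓ m a₀ p v := by
  have hd' : (0:ℝ) < d := by exact_mod_cast hd
  have hp0 : 0 < p := by linarith
  have hm0 : (0:ℝ) ≤ m := Nat.cast_nonneg m
  have hdp : 2 * (d:ℝ) / p = d / p + d / p := by ring
  have hpos : 0 < 2 * (d:ℝ) / p - m := by rw [hdp]; linarith
  have hlt : 2 * (d:ℝ) / p - m ≤ d := by
    have : 2 * d * (1 / p - 1 / 2) = 2 * (d:ℝ) / p - d := by ring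
    linarith
  set t : ℝ := (d : ℝ) / (2 * d / p - m) with htdef
  have ht1 : 1 ≤ t := (one_le_div hpos).2 hlt
  have ht0 : 0 < t := by linarith
  obtain ⟨T, hT⟩ : ∃ T : ℝ≥0, (T:ℝ) = t := ⟨⟨t, ht0.le⟩, rfl⟩
  have hT1 : 1 ≤ T := by
    have : (1:ℝ) ≤ T := by rw [hT]; exact ht1
    exact_mod_cast this
  have hTinv : (T:ℝ)⁻¹ = 2 / p - m / d := by
    rw [hT, htdef]
    field_simp
  have hT0 : T ≠ 0 := (lt_of_lt_of_le one_pos hT1).ne'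
  have key : ∀ γ : Fin d → ℕ, ∃ (L : List ((Fin d → ℕ) × (Fin d → ℕ))) (C : ℝ≥0),
      γ ∈ multiIdx d m →
      ∀ u v Du Dv, KMemData d (ModelDomain d ℓ) (rhoModel d ℓ) m a₀ p u Du →
        KMemData d (ModelDomain d ℓ) (rhoModel d ℓ) m a₀ p v Dv →
        HasWeakDerivOn d (ModelDomain d ℓ) γ (u * v)
          (fun x => (L.map fun b => Du b.1 x * Dv b.2 x).sum) ∧
        NN d ℓ (((∑ i, γ i : ℕ) : ℝ) - a₁) T (fun x => (L.map fun b => Du b.1 x * Dv b.2 x).sum) ≤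
          C * (ENNReal.ofReal (KnormP d (ModelDomain d ℓ) (rhoModel d ℓ) m a₀ p Du) *
            ENNReal.ofReal (KnormP d (ModelDomain d ℓ) (rhoModel d ℓ) m a₀ p Dv)) := by
    intro γ
    by_cases hγ : γ ∈ multiIdx d m
    · obtain ⟨L, C, h⟩ := prod_bound ℓ hd hp h1 h2 a₀ a₁ ha hT1 hTinv γ (mem_multiIdx.1 hγ)
      exact ⟨L, C, fun _ => h⟩
    · exact ⟨[], 0, fun h => absurd h hγ⟩
  choose L C hLC using key
  set S : ℝ := ∑ γ ∈ multiIdx d m, (C γ : ℝ) ^ t with hS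
  have hS0 : 0 ≤ S := Finset.sum_nonneg fun _ _ => Real.rpow_nonneg (NNReal.coe_nonneg _) _
  have hSt : 0 ≤ S ^ (1 / t) := Real.rpow_nonneg hS0 _
  refine ⟨S ^ (1 / t) + 1, by linarith, fun u v hu hv => ?_⟩
  have eu : KnormM d ℓ m a₀ p u =
      KnormP d (ModelDomain d ℓ) (rhoModel d ℓ) m a₀ p (Exists.choose hu) := by
    exact dif_pos hu
  have ev : KnormM d ℓ m a₀ p v =
      KnormP d (ModelDomain d ℓ) (rhoModel d ℓ) m a₀ p (Exists.choose hv) := by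
    exact dif_pos hv
  have hu' := Exists.choose_spec hu
  have hv' := Exists.choose_spec hv
  set Du := Exists.choose hu
  set Dv := Exists.choose hv
  set Ku := KnormP d (ModelDomain d ℓ) (rhoModel d ℓ) m a₀ p Du with hKu
  set Kv := KnormP d (ModelDomain d ℓ) (rhoModel d ℓ) m a₀ p Dv with hKv
  have hKu0 : 0 ≤ Ku := knorm_nonneg _
  have hKv0 : 0 ≤ Kv := knorm_nonneg _
  set E : (Fin d → ℕ) → Ed d → ℝ :=
    fun γ x => ((L γ).map fun b => Du b.1 x * Dv b.2 x).sum with hE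
  have hEb : ∀ γ ∈ multiIdx d m, NN d ℓ (((∑ i, γ i : ℕ) : ℝ) - a₁) T (E γ) ≤
      ENNReal.ofReal (C γ * (Ku * Kv)) := by
    intro γ hγ
    refine ((hLC γ hγ u v Du Dv hu' hv').2).trans (le_of_eq ?_)
    rw [ENNReal.ofReal_mul (NNReal.coe_nonneg _), ENNReal.ofReal_mul hKu0, ENNReal.ofReal_coe_nnreal]
  have hEl : ∀ γ ∈ multiIdx d m, LocallyIntegrableOn (E γ) (ModelDomain d ℓ) volume := fun γ hγ =>
    ((hLC γ hγ u v Du Dv hu' hv').1).2.1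
  have hEd : KMemData d (ModelDomain d ℓ) (rhoModel d ℓ) m a₁ t (u * v) E := by
    refine ⟨fun γ hγ => (hLC γ hγ u v Du Dv hu' hv').1, fun γ hγ => ?_⟩
    rw [← hT]
    exact (k_int hT0 (hEl γ hγ)).2 ((hEb γ hγ).trans_lt ENNReal.ofReal_lt_top)
  have hmem : MemKM d ℓ m a₁ t (u * v) := ⟨E, hEd⟩
  refine ⟨hmem, ?_⟩
  have euv : KnormM d ℓ m a₁ t (u * v) = KnormP d (ModelDomain d ℓ) (rhoModel d ℓ) m a₁ t E := by
    refine (dif_pos hmem : KnormM d ℓ m a₁ t (u * v) =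
      KnormP d (ModelDomain d ℓ) (rhoModel d ℓ) m a₁ t (Exists.choose hmem)).trans ?_
    exact knorm_congr (Exists.choose_spec hmem) hEd
  rw [euv, eu, ev]
  have hI : ∀ γ ∈ multiIdx d m,
      ∫ x in ModelDomain d ℓ, kIntegrand d (rhoModel d ℓ) a₁ t γ (E γ) x ≤
        (C γ : ℝ) ^ t * (Ku * Kv) ^ t := by
    intro γ hγ
    have hb := hEb γ hγ
    rw [k_norm hT0 (hEl γ hγ) (hb.trans_lt ENNReal.ofReal_lt_top), hT] at hb
    have hCK : 0 ≤ (C γ : ℝ) * (Ku * Kv) := by positivity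
    have h3 := (ENNReal.ofReal_le_ofReal_iff hCK).1 hb
    have h4 := Real.rpow_le_rpow (Real.rpow_nonneg (k_nonneg _) _) h3 ht0.le
    rw [← Real.rpow_mul (k_nonneg _), inv_mul_cancel₀ ht0.ne', Real.rpow_one,
      Real.mul_rpow (NNReal.coe_nonneg _) (mul_nonneg hKu0 hKv0)] at h4
    exact h4
  have hfin : KnormP d (ModelDomain d ℓ) (rhoModel d ℓ) m a₁ t E ≤ S ^ (1 / t) * (Ku * Kv) := by
    have hsum := Finset.sum_le_sum hI
    rw [← Finset.sum_mul] at hsum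
    have h5 := Real.rpow_le_rpow (z := 1 / t) (Finset.sum_nonneg fun _ _ => k_nonneg _) hsum
      (by positivity)
    refine h5.trans (le_of_eq ?_)
    rw [Real.mul_rpow hS0 (by positivity), ← Real.rpow_mul (mul_nonneg hKu0 hKv0), mul_one_div_cancel ht0.ne',
      Real.rpow_one]
  refine hfin.trans ?_
  rw [mul_assoc]
  exact mul_le_mul_of_nonneg_right (by linarith) (mul_nonneg hKu0 hKv0)

end Kon

/-- Theorem `mult112`: for `1 < p < ∞`, `2d(1/p - 1/2) < m < d/p`, `t = d/(2d/p - m)` and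
any `a₁ < 2a₀ - m` there is a constant `c` with
`‖u·v|𝒦^m_{a₁,t}‖ ≤ c ‖u|𝒦^m_{a₀,p}‖ ‖v|𝒦^m_{a₀,p}‖` in the model case. -/
theorem statement15 (d ℓ m : ℕ) (hd : 2 ≤ d) (hl : ℓ < d) (hm : 1 ≤ m)
    (a₀ p : ℝ) (hp : 1 < p)
    (h1 : 2 * d * (1 / p - 1 / 2) < m) (h2 : (m : ℝ) < d / p) :
    ∀ a₁ : ℝ, a₁ < 2 * a₀ - m →
      ∃ c : ℝ, 0 < c ∧ ∀ u v : Ed d → ℝ,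
        MemKM d ℓ m a₀ p u → MemKM d ℓ m a₀ p v →
        MemKM d ℓ m a₁ ((d : ℝ) / (2 * d / p - m)) (u * v) ∧
        KnormM d ℓ m a₁ ((d : ℝ) / (2 * d / p - m)) (u * v) ≤
          c * KnormM d ℓ m a₀ p u * KnormM d ℓ m a₀ p v := by
  intro a₁ ha
  exact Kon.main d ℓ m (by omega) a₀ p hp h1 h2 a₁ ha

end
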